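/- ∫_0^1 3^{5/4} [K(√t)]³ / (2^{5/6} (t(1-t))^{1/6}) dt = (π³/8) · 3^{3/2}(2-√3) Γ(1/4)⁸ / (2⁴ π⁵), i.e., equals 3^{3/2}(2-√3) Γ(1/4)⁸ / (2⁷ π²). -/

import Mathlib

open Real MeasureTheory intervalIntegral Complex

/-- Complete elliptic integral of the first kind. -/
noncomputable def ellipticK (k : ℝ) : ℝ :=
  ∫ θ in (0:ℝ)..(π/2), (1 - k ^ 2 * Real.sin θ ^ 2) ^ (-(1/2 : ℝ))

/-- Complete elliptic integral of the second kind. -/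
noncomputable def ellipticE (k : ℝ) : ℝ :=
  ∫ θ in (0:ℝ)..(π/2), (1 - k ^ 2 * Real.sin θ ^ 2) ^ ((1/2 : ℝ))

/-- Legendre function of the first kind of degree ν : P_ν(1-2z) = ₂F₁(-ν, ν+1; 1; z). -/
noncomputable def legendreP (ν : ℂ) (x : ℂ) : ℂ :=
  ordinaryHypergeometric (-ν) (ν + 1) 1 ((1 - x) / 2)


def PolyB (c : ℤ → ℝ) : Prop := ∃ C : ℝ, ∃ k : ℕ, 0 ≤ C ∧ ∀ n, |c n| ≤ C * (1 + |(n:ℝ)|) ^ k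

noncomputable def PS (c : ℤ → ℝ) (κ : ℝ) (s : ℂ) : ℂ :=
  ∑' n : ℤ, (c n : ℂ) * cexp (-(π * (n + κ) ^ 2 : ℝ) * s)

noncomputable def PR (c : ℤ → ℝ) (κ : ℝ) (y : ℝ) : ℝ :=
  ∑' n : ℤ, c n * rexp (-(π * (n + κ) ^ 2) * y)

lemma PolyB.mul {c d : ℤ → ℝ} (hc : PolyB c) (hd : PolyB d) : PolyB (fun n => c n * d n) := by
  obtain ⟨C, k, hC, h⟩ := hc
  obtain ⟨D, l, hD, h'⟩ := hd
  refine ⟨C * D, k + l, by positivity, fun n => ?_⟩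
  rw [abs_mul]
  calc |c n| * |d n| ≤ (C * (1 + |(n:ℝ)|) ^ k) * (D * (1 + |(n:ℝ)|) ^ l) := by
        gcongr
        · exact h n
        · exact h' n
    _ = _ := by ring

lemma polyB_sq (κ : ℝ) : PolyB (fun n => -(π * (n + κ) ^ 2)) := by
  refine ⟨π * (1 + |κ|) ^ 2, 2, by positivity, fun n => ?_⟩
  rw [abs_neg, abs_mul, abs_of_pos pi_pos, abs_pow, mul_assoc, ← mul_pow]
  gcongr
  calc |(n:ℝ) + κ| ≤ |(n:ℝ)| + |κ| := abs_add_le _ _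
    _ ≤ _ := by nlinarith [abs_nonneg (n:ℝ), abs_nonneg κ]

lemma polyB_of_bdd {c : ℤ → ℝ} {C : ℝ} (hC : 0 ≤ C) (h : ∀ n, |c n| ≤ C) : PolyB c :=
  ⟨C, 0, hC, by simpa using h⟩

lemma one_add_pow_le (x : ℝ) (hx : 0 ≤ x) (k : ℕ) : (1 + x) ^ k ≤ 2 ^ k * (1 + x ^ k) := by
  rcases le_total x 1 with h | h
  · calc (1 + x) ^ k ≤ 2 ^ k := by gcongr; linarith
      _ ≤ _ := by
        have : 0 ≤ x ^ k := by positivity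
        nlinarith [pow_pos (two_pos : (0:ℝ) < 2) k]
  · calc (1 + x) ^ k ≤ (2 * x) ^ k := by gcongr; linarith
      _ = 2 ^ k * x ^ k := mul_pow _ _ _
      _ ≤ _ := by gcongr; linarith

lemma PolyB.summable {c : ℤ → ℝ} (hc : PolyB c) (κ : ℝ) {δ : ℝ} (hδ : 0 < δ) :
    Summable (fun n : ℤ => |c n| * rexp (-(π * (n + κ) ^ 2) * δ)) := by
  obtain ⟨C, k, hC, h⟩ := hc
  have h0 := summable_pow_mul_jacobiTheta₂_term_bound (|κ| * δ) hδ 0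
  have h1 := summable_pow_mul_jacobiTheta₂_term_bound (|κ| * δ) hδ k
  refine Summable.of_nonneg_of_le (fun n => by positivity) (fun n => ?_)
    ((h0.add h1).mul_left (C * 2 ^ k))
  have e1 : rexp (-(π * (n + κ) ^ 2) * δ) ≤
      rexp (-π * (δ * (n:ℝ) ^ 2 - 2 * (|κ| * δ) * ((|n| : ℤ) : ℝ))) := by
    apply Real.exp_le_exp.mpr
    push_cast
    have : -(|κ| * |(n:ℝ)|) ≤ n * κ := by
      rw [← abs_mul, mul_comm κ]; exact neg_abs_le _
    have h2 : 0 ≤ κ ^ 2 := sq_nonneg _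
    have hp : 0 < π * δ := by positivity
    nlinarith [mul_nonneg hp.le h2, mul_le_mul_of_nonneg_left this hp.le]
  calc _ ≤ (C * (1 + |(n:ℝ)|) ^ k) *
        rexp (-π * (δ * (n:ℝ) ^ 2 - 2 * (|κ| * δ) * ((|n| : ℤ) : ℝ))) := by
        gcongr
        exact h n
    _ ≤ (C * (2 ^ k * (1 + |(n:ℝ)| ^ k))) *
        rexp (-π * (δ * (n:ℝ) ^ 2 - 2 * (|κ| * δ) * ((|n| : ℤ) : ℝ))) := by
        gcongr
        exact one_add_pow_le _ (abs_nonneg _) _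
    _ = _ := by push_cast; ring

lemma norm_PS_term (c : ℤ → ℝ) (κ : ℝ) (s : ℂ) (n : ℤ) :
    ‖(c n : ℂ) * cexp (-(π * (n + κ) ^ 2 : ℝ) * s)‖ =
      |c n| * rexp (-(π * (n + κ) ^ 2) * s.re) := by
  rw [norm_mul, Complex.norm_exp, Complex.norm_real, Real.norm_eq_abs, ← ofReal_neg, re_ofReal_mul]

lemma PolyB.summable_norm {c : ℤ → ℝ} (hc : PolyB c) (κ : ℝ) {s : ℂ} (hs : 0 < s.re) :
    Summable (fun n : ℤ => ‖(c n : ℂ) * cexp (-(π * (n + κ) ^ 2 : ℝ) * s)‖) := by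
  simp_rw [norm_PS_term]
  exact hc.summable κ hs

lemma PolyB.summableC {c : ℤ → ℝ} (hc : PolyB c) (κ : ℝ) {s : ℂ} (hs : 0 < s.re) :
    Summable (fun n : ℤ => (c n : ℂ) * cexp (-(π * (n + κ) ^ 2 : ℝ) * s)) :=
  (hc.summable_norm κ hs).of_norm

lemma PolyB.summableR {c : ℤ → ℝ} (hc : PolyB c) (κ : ℝ) {y : ℝ} (hs : 0 < y) :
    Summable (fun n : ℤ => c n * rexp (-(π * (n + κ) ^ 2) * y)) := by
  apply Summable.of_norm
  refine (hc.summable κ hs).congr fun n => ?_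
  simp

lemma PolyB.hasDerivAt {c : ℤ → ℝ} (hc : PolyB c) (κ : ℝ) {s : ℂ} (hs : 0 < s.re) :
    HasDerivAt (PS c κ) (PS (fun n => c n * -(π * (n + κ) ^ 2)) κ s) s := by
  have hc' := hc.mul (polyB_sq κ)
  have hδ : 0 < s.re / 2 := by positivity
  have := hasDerivAt_tsum_of_isPreconnected (𝕜 := ℂ) (F := ℂ) (α := ℤ)
    (g := fun n s => (c n : ℂ) * cexp (-(π * (n + κ) ^ 2 : ℝ) * s))
    (g' := fun n s => ((c n * -(π * (n + κ) ^ 2) : ℝ) : ℂ) * cexp (-(π * (n + κ) ^ 2 : ℝ) * s))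
    (t := {s' : ℂ | s.re / 2 < s'.re}) (y₀ := s) (y := s)
    (hc'.summable κ hδ) (isOpen_lt continuous_const Complex.continuous_re)
    (convex_halfSpace_re_gt _).isPreconnected ?_ ?_ ?_ ?_ ?_
  · exact this
  · intro n y _
    have h1 : HasDerivAt (fun s : ℂ => -((π * (n + κ) ^ 2 : ℝ) : ℂ) * s)
        (-((π * (n + κ) ^ 2 : ℝ) : ℂ)) y := by
      have := (hasDerivAt_id y).const_mul (-((π * (n + κ) ^ 2 : ℝ) : ℂ))
      rw [mul_one] at this
      exact this
    have h2 := h1.cexp.const_mul (c n : ℂ)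
    refine h2.congr_deriv ?_
    rw [Complex.ofReal_mul (c n), Complex.ofReal_neg]; ring
  · intro n y hy
    rw [norm_PS_term (fun n => c n * -(π * (n + κ) ^ 2)) κ y n]
    have hy' : s.re / 2 < y.re := hy
    have : 0 ≤ π * (n + κ) ^ 2 := by positivity
    gcongr ?_ * rexp ?_
    nlinarith
  · simpa using hs
  · exact hc.summableC κ hs
  · simpa using hs

lemma PS_ofReal (c : ℤ → ℝ) (κ y : ℝ) : PS c κ (y : ℂ) = (PR c κ y : ℂ) := by
  unfold PS PR
  rw [Complex.ofReal_tsum]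
  push_cast
  rfl

lemma PolyB.hasDerivAtR {c : ℤ → ℝ} (hc : PolyB c) (κ : ℝ) {y : ℝ} (hs : 0 < y) :
    HasDerivAt (PR c κ) (PR (fun n => c n * -(π * (n + κ) ^ 2)) κ y) y := by
  have := (hc.hasDerivAt κ (s := (y:ℂ)) (by simpa using hs)).real_of_complex
  simpa [PS_ofReal] using this

lemma PolyB.tendsto {c : ℤ → ℝ} (hc : PolyB c) (κ : ℝ) (d : ℝ)
    (hd : ∀ n : ℤ, c n ≠ 0 → d ≤ (n + κ) ^ 2) :
    Filter.Tendsto (fun s : ℂ => cexp ((π * d : ℝ) * s) * PS c κ s)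
      (Filter.comap Complex.re Filter.atTop)
      (nhds (∑' n : ℤ, if ((n:ℝ) + κ) ^ 2 = d then (c n : ℂ) else 0)) := by
  have key := tendsto_tsum_of_dominated_convergence (𝓕 := Filter.comap Complex.re Filter.atTop)
    (f := fun (s:ℂ) (n:ℤ) => cexp ((π * d : ℝ) * s) * ((c n : ℂ) * cexp (-(π * (n + κ) ^ 2 : ℝ) * s)))
    (g := fun n => if ((n:ℝ) + κ) ^ 2 = d then (c n : ℂ) else 0)
    (bound := fun n : ℤ => rexp (π * d) * (|c n| * rexp (-(π * (n + κ) ^ 2) * 1)))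
    ((hc.summable κ one_pos).mul_left _) ?_ ?_
  · refine key.congr fun s => ?_
    rw [PS, tsum_mul_left]
  · intro n
    have e : ∀ s : ℂ, cexp ((π * d : ℝ) * s) * ((c n : ℂ) * cexp (-(π * (n + κ) ^ 2 : ℝ) * s))
        = (c n : ℂ) * cexp (-((π * ((n + κ) ^ 2 - d) : ℝ) * s)) := by
      intro s
      rw [mul_left_comm, ← Complex.exp_add]
      congr 2
      push_cast; ring
    simp_rw [e]
    by_cases h : ((n:ℝ) + κ) ^ 2 = d
    · simp only [h, sub_self, mul_zero, Complex.ofReal_zero, zero_mul, neg_zero, Complex.exp_zero, mul_one, if_true]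
      exact tendsto_const_nhds
    · simp only [h, if_false]
      by_cases hc0 : c n = 0
      · simp only [hc0, Complex.ofReal_zero, zero_mul]
        exact tendsto_const_nhds
      have hlt : 0 < π * ((n + κ) ^ 2 - d) := by
        have := lt_of_le_of_ne (hd n hc0) (Ne.symm h)
        have := sub_pos.mpr this
        positivity
      rw [← mul_zero (c n : ℂ)]
      apply Filter.Tendsto.const_mul
      rw [tendsto_zero_iff_norm_tendsto_zero]
      simp_rw [Complex.norm_exp, Complex.neg_re, Complex.re_ofReal_mul]
      apply Real.tendsto_exp_neg_atTop_nhds_zero.comp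
      exact Filter.Tendsto.const_mul_atTop hlt Filter.tendsto_comap
  · have : ∀ᶠ s : ℂ in Filter.comap Complex.re Filter.atTop, 1 ≤ s.re :=
      Filter.tendsto_comap.eventually (Filter.eventually_ge_atTop 1)
    filter_upwards [this] with s hs n
    rw [norm_mul, norm_PS_term, Complex.norm_exp, Complex.re_ofReal_mul]
    by_cases hc0 : c n = 0
    · simp [hc0]
    have h1 := hd n hc0
    rw [mul_left_comm, mul_left_comm (rexp (π * d)), ← Real.exp_add, ← Real.exp_add]
    refine mul_le_mul_of_nonneg_left (Real.exp_le_exp.mpr ?_) (abs_nonneg _)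
    have : 0 ≤ π * ((n + κ) ^ 2 - d) := by
      have := sub_nonneg.mpr h1
      positivity
    nlinarith

lemma PolyB.tendstoR {c : ℤ → ℝ} (hc : PolyB c) (κ : ℝ) (d : ℝ)
    (hd : ∀ n : ℤ, c n ≠ 0 → d ≤ (n + κ) ^ 2) :
    Filter.Tendsto (fun y : ℝ => rexp (π * d * y) * PR c κ y) Filter.atTop
      (nhds (∑' n : ℤ, if ((n:ℝ) + κ) ^ 2 = d then c n else 0)) := by
  have h := hc.tendsto κ d hd
  have h2 : Filter.Tendsto (fun y : ℝ => (y:ℂ)) Filter.atTop (Filter.comap Complex.re Filter.atTop) := by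
    rw [Filter.tendsto_comap_iff]
    exact Filter.tendsto_id
  have h3 := (Complex.continuous_re.tendsto _).comp (h.comp h2)
  have e : (∑' n : ℤ, if ((n:ℝ) + κ) ^ 2 = d then (c n : ℂ) else 0) =
      ((∑' n : ℤ, if ((n:ℝ) + κ) ^ 2 = d then c n else 0 : ℝ) : ℂ) := by
    rw [Complex.ofReal_tsum]
    congr 1; ext n; split_ifs <;> simp
  rw [e, Complex.ofReal_re] at h3
  refine h3.congr fun y => ?_
  simp only [Function.comp, PS_ofReal, ← Complex.ofReal_mul, ← Complex.ofReal_exp, Complex.ofReal_re]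


/-- shear equivalence -/
def shearE (N : ℕ) [NeZero N] : (ℤ × ℤ) × Fin N ≃ ℤ × ℤ where
  toFun p := (p.1.1 + (N - 1) * p.1.2 + (p.2 : ℕ), p.1.1 - p.1.2)
  invFun q := ((q.2 + ((Int.divModEquiv N) (q.1 - q.2)).1, ((Int.divModEquiv N) (q.1 - q.2)).1),
    ((Int.divModEquiv N) (q.1 - q.2)).2)
  left_inv p := by
    obtain ⟨⟨a, b⟩, j⟩ := p
    have : (a + (N - 1) * b + (j : ℕ)) - (a - b) = (Int.divModEquiv N).symm (b, j) := by
      simp [Int.divModEquiv]; ring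
    simp only [this, Equiv.apply_symm_apply]
    simp
  right_inv q := by
    obtain ⟨m, n⟩ := q
    have h := (Int.divModEquiv N).symm_apply_apply (m - n)
    dsimp only
    generalize (Int.divModEquiv N) (m - n) = r at *
    obtain ⟨b, j⟩ := r
    simp [Int.divModEquiv] at h
    ext
    · dsimp only; linarith
    · simp

lemma tsum_shear (N : ℕ) [NeZero N] (F : ℤ × ℤ → ℂ) (hF : Summable F) :
    ∑' p, F p = ∑ j : Fin N, ∑' q : ℤ × ℤ, F (q.1 + (N - 1) * q.2 + (j : ℕ), q.1 - q.2) := by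
  rw [← (shearE N).tsum_eq F]
  have h1 : Summable (fun p => F (shearE N p)) := (shearE N).summable_iff.mpr hF
  have h2 : Summable (fun p : Fin N × (ℤ × ℤ) => F (shearE N (p.2, p.1))) :=
    (Equiv.prodComm (Fin N) (ℤ × ℤ)).summable_iff.mpr h1
  rw [← (Equiv.prodComm (Fin N) (ℤ × ℤ)).tsum_eq]
  have := h2.tsum_prod
  simp only [Equiv.prodComm_apply, Prod.swap] 
  rw [this, tsum_fintype]
  rfl

lemma tsum_divmod (N : ℕ) [NeZero N] (F : ℤ → ℂ) (hF : Summable F) :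
    ∑' p, F p = ∑ j : Fin N, ∑' a : ℤ, F (N * a + (j : ℕ)) := by
  rw [← (Int.divModEquiv N).symm.tsum_eq F]
  have h1 : Summable (fun p => F ((Int.divModEquiv N).symm p)) :=
    (Int.divModEquiv N).symm.summable_iff.mpr hF
  have h2 : Summable (fun p : Fin N × ℤ => F ((Int.divModEquiv N).symm (p.2, p.1))) :=
    (Equiv.prodComm (Fin N) ℤ).summable_iff.mpr h1
  rw [← (Equiv.prodComm (Fin N) ℤ).tsum_eq]
  have := h2.tsum_prod
  simp only [Equiv.prodComm_apply, Prod.swap] 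
  rw [this, tsum_fintype]
  simp [Int.divModEquiv, mul_comm]

lemma PS_mul_PS {c d : ℤ → ℝ} (hc : PolyB c) (hd : PolyB d) (κ κ' : ℝ) {s t : ℂ} (hs : 0 < s.re)
    (ht : 0 < t.re) :
    Summable (fun p : ℤ × ℤ => (c p.1 : ℂ) * cexp (-(π * (p.1 + κ) ^ 2 : ℝ) * s) *
      ((d p.2 : ℂ) * cexp (-(π * (p.2 + κ') ^ 2 : ℝ) * t))) ∧
    PS c κ s * PS d κ' t = ∑' p : ℤ × ℤ, (c p.1 : ℂ) * cexp (-(π * (p.1 + κ) ^ 2 : ℝ) * s) *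
      ((d p.2 : ℂ) * cexp (-(π * (p.2 + κ') ^ 2 : ℝ) * t)) := by
  have h1 := hc.summable_norm κ hs
  have h2 := hd.summable_norm κ' ht
  exact ⟨summable_mul_of_summable_norm (f := fun n : ℤ => (c n : ℂ) * cexp (-(π * (n + κ) ^ 2 : ℝ) * s))
    (g := fun n : ℤ => (d n : ℂ) * cexp (-(π * (n + κ') ^ 2 : ℝ) * t)) h1 h2,
    tsum_mul_tsum_of_summable_norm (f := fun n : ℤ => (c n : ℂ) * cexp (-(π * (n + κ) ^ 2 : ℝ) * s))
    (g := fun n : ℤ => (d n : ℂ) * cexp (-(π * (n + κ') ^ 2 : ℝ) * t)) h1 h2⟩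

/-- doubling -/
lemma PS_double {c d e0 f0 e1 f1 : ℤ → ℝ} (hc : PolyB c) (hd : PolyB d) (he0 : PolyB e0)
    (hf0 : PolyB f0) (he1 : PolyB e1) (hf1 : PolyB f1) (κ κ' : ℝ) {s : ℂ} (hs : 0 < s.re)
    (h0 : ∀ a b, c (a + b) * d (a - b) = e0 a * f0 b)
    (h1 : ∀ a b, c (a + b + 1) * d (a - b) = e1 a * f1 b) :
    PS c κ s * PS d κ' s = PS e0 ((κ + κ') / 2) (2 * s) * PS f0 ((κ - κ') / 2) (2 * s) +
      PS e1 ((κ + κ' + 1) / 2) (2 * s) * PS f1 ((κ - κ' + 1) / 2) (2 * s) := by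
  have hs2 : 0 < (2 * s).re := by simpa using hs
  rw [(PS_mul_PS hc hd κ κ' hs hs).2, tsum_shear 2 _ (PS_mul_PS hc hd κ κ' hs hs).1,
    (PS_mul_PS he0 hf0 _ _ hs2 hs2).2, (PS_mul_PS he1 hf1 _ _ hs2 hs2).2, Fin.sum_univ_two]
  congr 1
  · congr 1; ext ⟨a, b⟩
    have := h0 a b
    simp only [Fin.val_zero, Nat.cast_zero, add_zero]
    norm_num
    rw [mul_mul_mul_comm, mul_mul_mul_comm (e0 a : ℂ), ← Complex.exp_add, ← Complex.exp_add,
      ← Complex.ofReal_mul, ← Complex.ofReal_mul, this]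
    congr 2; push_cast; ring
  · congr 1; ext ⟨a, b⟩
    have := h1 a b
    simp only [Fin.val_one, Nat.cast_one]
    norm_num
    rw [mul_mul_mul_comm, mul_mul_mul_comm (e1 a : ℂ), ← Complex.exp_add, ← Complex.exp_add,
      ← Complex.ofReal_mul, ← Complex.ofReal_mul, this]
    congr 2; push_cast; ring

lemma PS_shift (c : ℤ → ℝ) (κ : ℝ) (k : ℤ) (s : ℂ) :
    PS c (κ + k) s = PS (fun n => c (n - k)) κ s := by
  unfold PS
  rw [← (Equiv.subRight k).tsum_eq]
  congr 1; ext n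
  simp only [Equiv.subRight_apply]
  push_cast
  congr 3; ring

lemma PS_neg (c : ℤ → ℝ) (κ : ℝ) (s : ℂ) :
    PS c (-κ) s = PS (fun n => c (-n)) κ s := by
  unfold PS
  rw [← (Equiv.neg ℤ).tsum_eq]
  congr 1; ext n
  simp only [Equiv.neg_apply]
  push_cast
  congr 3; ring

noncomputable def c1 : ℤ → ℝ := fun _ => 1
noncomputable def ca : ℤ → ℝ := fun n => (-1) ^ n
noncomputable def cm : ℤ → ℝ := fun _ => -1
noncomputable def cf : ℤ → ℝ := fun n => (-1) ^ n * (2 * n + 1)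
noncomputable def cg : ℤ → ℝ := fun n => (-1) ^ n * (2 * n + 1) ^ 3

lemma ca_add (m n : ℤ) : ca (m + n) = ca m * ca n := zpow_add₀ (by norm_num) m n
lemma ca_one : ca 1 = -1 := by simp [ca]
lemma ca_neg (n : ℤ) : ca (-n) = ca n := by simp [ca, ← inv_zpow]
lemma ca_sub (m n : ℤ) : ca (m - n) = ca m * ca n := by rw [sub_eq_add_neg, ca_add, ca_neg]
lemma ca_sq (n : ℤ) : ca n * ca n = 1 := by rw [← ca_sub]; simp [ca]
lemma abs_ca (n : ℤ) : |ca n| = 1 := by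
  have := ca_sq n
  rw [← sq, ← sq_abs] at this
  nlinarith [abs_nonneg (ca n)]

lemma B1 : PolyB c1 := polyB_of_bdd zero_le_one (by simp [c1])
lemma Bm : PolyB cm := polyB_of_bdd zero_le_one (by simp [cm])
lemma Ba : PolyB ca := polyB_of_bdd zero_le_one (fun n => (abs_ca n).le)
lemma Blin : PolyB (fun n => 2 * (n:ℝ) + 1) := by
  refine ⟨2, 1, by norm_num, fun n => ?_⟩
  calc |2 * (n:ℝ) + 1| ≤ |2 * (n:ℝ)| + |1| := abs_add_le _ _
    _ ≤ _ := by rw [abs_mul]; simp; linarith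
lemma Bf : PolyB cf := Ba.mul Blin
lemma Bg : PolyB cg := by
  have := Ba.mul (Blin.mul (Blin.mul Blin))
  convert this using 1
  ext n; simp only [cg, ca]; ring

noncomputable def T3 : ℂ → ℂ := PS c1 0
noncomputable def T4 : ℂ → ℂ := PS ca 0
noncomputable def T2 : ℂ → ℂ := PS c1 (1/2)
noncomputable def F1 : ℂ → ℂ := PS cf (1/2)
noncomputable def F3 : ℂ → ℂ := PS cg (1/2)
noncomputable def r3 : ℝ → ℝ := PR c1 0
noncomputable def r4 : ℝ → ℝ := PR ca 0
noncomputable def r2 : ℝ → ℝ := PR c1 (1/2)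
noncomputable def f1 : ℝ → ℝ := PR cf (1/2)
noncomputable def f3 : ℝ → ℝ := PR cg (1/2)

lemma T3r (y : ℝ) : T3 y = r3 y := PS_ofReal _ _ _
lemma T4r (y : ℝ) : T4 y = r4 y := PS_ofReal _ _ _
lemma T2r (y : ℝ) : T2 y = r2 y := PS_ofReal _ _ _
lemma F1r (y : ℝ) : F1 y = f1 y := PS_ofReal _ _ _
lemma F3r (y : ℝ) : F3 y = f3 y := PS_ofReal _ _ _

lemma PS_ca_half (s : ℂ) : PS ca (1/2) s = 0 := by
  have h1 : PS ca (1/2) s = PS (fun n => ca (-n)) (-(1/2)) s := by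
    have := PS_neg ca (-(1/2)) s
    rwa [neg_neg] at this
  have h2 : PS ca (1/2) s = PS (fun n => ca (n-1)) (-(1/2)) s := by
    have := PS_shift ca (-(1/2)) 1 s
    norm_num at this ⊢
    exact this
  have h3 : PS (fun n => ca (n-1)) (-(1/2)) s = - PS (fun n => ca (-n)) (-(1/2)) s := by
    unfold PS
    rw [← tsum_neg]
    congr 1; ext n
    simp only [ca_sub, ca_neg, ca_one]; push_cast; ring
  have : PS ca (1/2) s = - PS ca (1/2) s := by
    nth_rw 1 [h2]; rw [h3, ← h1]
  exact self_eq_neg.mp this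

lemma PS_cm (κ : ℝ) (s : ℂ) : PS cm κ s = - PS c1 κ s := by
  unfold PS
  rw [← tsum_neg]
  congr 1; ext n; simp [cm, c1]

lemma PS_c1_one (s : ℂ) : PS c1 1 s = PS c1 0 s := by
  have := PS_shift c1 0 1 s
  simp at this; exact this

lemma T3_sq {s : ℂ} (hs : 0 < s.re) : T3 s ^ 2 = T3 (2 * s) ^ 2 + T2 (2 * s) ^ 2 := by
  have := PS_double B1 B1 B1 B1 B1 B1 0 0 hs (by simp [c1]) (by simp [c1])
  simp only [T3, T2, sq, this]; norm_num

lemma T4_sq {s : ℂ} (hs : 0 < s.re) : T4 s ^ 2 = T3 (2 * s) ^ 2 - T2 (2 * s) ^ 2 := by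
  have := PS_double Ba Ba B1 B1 Bm B1 0 0 hs
    (by intro a b; rw [ca_add, ca_sub]; simp [c1]; linear_combination ca b * ca b * ca_sq a + ca_sq b)
    (by intro a b; rw [ca_add, ca_add, ca_sub, ca_one]; simp [c1, cm]
        linear_combination ca b * ca b * ca_sq a + ca_sq b)
  simp only [T4, T3, T2, sq, this, PS_cm]; norm_num; ring

lemma T3_T4 {s : ℂ} (hs : 0 < s.re) : T3 s * T4 s = T4 (2 * s) ^ 2 := by
  have := PS_double B1 Ba Ba Ba Ba Ba 0 0 hs
    (by intro a b; rw [ca_sub]; simp [c1])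
    (by intro a b; rw [ca_sub]; simp [c1])
  have h := PS_ca_half (2 * s)
  simp only [T4, T3, sq, this]; norm_num at h ⊢; rw [h]

lemma T2_sq {s : ℂ} (hs : 0 < s.re) : T2 s ^ 2 = 2 * T2 (2 * s) * T3 (2 * s) := by
  have := PS_double B1 B1 B1 B1 B1 B1 (1/2) (1/2) hs (by simp [c1]) (by simp [c1])
  simp only [T3, T2, sq, this]; norm_num; rw [PS_c1_one]; ring

lemma T_jacobi {s : ℂ} (hs : 0 < s.re) : T3 s ^ 4 = T2 s ^ 4 + T4 s ^ 4 := by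
  have h3 := T3_sq hs
  have h4 := T4_sq hs
  have h2 := T2_sq hs
  rw [show T3 s ^ 4 = (T3 s ^ 2) ^ 2 by ring, show T2 s ^ 4 = (T2 s ^ 2) ^ 2 by ring,
    show T4 s ^ 4 = (T4 s ^ 2) ^ 2 by ring, h3, h4, h2]
  ring

/-! S and T -/
lemma PS_eq_jacobi1 (κ : ℝ) (s : ℂ) :
    PS c1 κ s = cexp (-(π * κ ^ 2) * s) * jacobiTheta₂ (κ * (I * s)) (I * s) := by
  unfold PS jacobiTheta₂
  rw [← tsum_mul_left]
  congr 1; ext n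
  rw [jacobiTheta₂_term, ← Complex.exp_add]
  simp only [c1, Complex.ofReal_one, one_mul]
  congr 1; push_cast
  linear_combination (-(2 * π * n * κ * s) - π * n ^ 2 * s) * I_sq

lemma cexp_pi_n (n : ℤ) : cexp (π * I * n) = (ca n : ℂ) := by
  rw [mul_comm, Complex.exp_int_mul, Complex.exp_pi_mul_I]; simp [ca]

lemma PS_eq_jacobia (κ : ℝ) (s : ℂ) :
    PS ca κ s = cexp (-(π * κ ^ 2) * s) * jacobiTheta₂ (1 / 2 + κ * (I * s)) (I * s) := by
  unfold PS jacobiTheta₂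
  rw [← tsum_mul_left]
  congr 1; ext n
  rw [jacobiTheta₂_term, ← Complex.exp_add, ← cexp_pi_n, ← Complex.exp_add]
  congr 1; push_cast
  linear_combination (-(2 * π * n * κ * s) - π * n ^ 2 * s) * I_sq

lemma PS_eq_jacobi' (κ : ℝ) {s : ℂ} (hs : 0 < s.re) :
    2 * π * I * PS (fun n => ca n * n) κ s =
      cexp (-(π * κ ^ 2) * s) * jacobiTheta₂' (1 / 2 + κ * (I * s)) (I * s) := by
  unfold PS jacobiTheta₂'
  rw [← tsum_mul_left, ← tsum_mul_left]
  congr 1; ext n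
  rw [jacobiTheta₂'_term, jacobiTheta₂_term, mul_left_comm (cexp _), ← Complex.exp_add,
    Complex.ofReal_mul, ← cexp_pi_n]
  push_cast
  rw [show 2 * (π:ℂ) * I * (cexp (π * I * n) * n * cexp (-(π * (n + κ) ^ 2) * s)) =
    2 * π * I * n * (cexp (π * I * n) * cexp (-(π * (n + κ) ^ 2) * s)) by ring, ← Complex.exp_add]
  congr 2
  linear_combination (-(2 * π * n * κ * s) - π * n ^ 2 * s) * I_sq

lemma Bn : PolyB (fun n => (n:ℝ)) := by
  refine ⟨1, 1, by norm_num, fun n => ?_⟩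
  simp

lemma F1_eq {s : ℂ} (hs : 0 < s.re) : F1 s = 2 * PS (fun n => ca n * n) (1/2) s := by
  have h0 := PS_ca_half s
  have : F1 s = 2 * PS (fun n => ca n * n) (1/2) s + PS ca (1/2) s := by
    unfold F1 PS
    rw [← tsum_mul_left, ← ((((Ba.mul Bn).summableC (1/2) hs).mul_left 2).tsum_add (Ba.summableC (1/2) hs))]
    congr 1; ext n
    simp only [cf, ← ca.eq_1]; push_cast [ca]; ring
  rw [this, h0, add_zero]

lemma F1_eq' {s : ℂ} (hs : 0 < s.re) : F1 s = -2 * PS (fun n => ca n * n) (-(1/2)) s := by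
  have h1 : PS (fun n => ca n * n) (-(1/2)) s = PS (fun n => ca (-n) * ((-n : ℤ):ℝ)) (1/2) s := PS_neg _ _ _
  rw [F1_eq hs, h1]
  have : PS (fun n => ca (-n) * ((-n : ℤ):ℝ)) (1/2) s = - PS (fun n => ca n * n) (1/2) s := by
    unfold PS
    rw [← tsum_neg]
    congr 1; ext n
    simp only [ca_neg]; push_cast; ring
  rw [this]; ring

lemma inv_re_pos {s : ℂ} (hs : 0 < s.re) : 0 < (s⁻¹).re := by
  rw [Complex.inv_re]
  have : 0 < normSq s := normSq_pos.mpr (by rintro rfl; simp at hs)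
  positivity

lemma ne0 {s : ℂ} (hs : 0 < s.re) : s ≠ 0 := by rintro rfl; simp at hs

lemma T3_S {s : ℂ} (hs : 0 < s.re) : T3 s⁻¹ = s ^ (1/2 : ℂ) * T3 s := by
  have h0 := ne0 hs
  have e := jacobiTheta₂_functional_equation 0 (I * s)
  have a1 : -I * (I * s) = s := by linear_combination (-s) * I_sq
  have a2 : -1 / (I * s) = I * s⁻¹ := by field_simp; linear_combination - I_sq
  rw [a1, a2] at e
  have h1 := PS_eq_jacobi1 0 s
  have h2 := PS_eq_jacobi1 0 s⁻¹
  simp at h1 h2 e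
  unfold T3
  rw [h1, h2, e]
  have : s ^ (2⁻¹ : ℂ) ≠ 0 := by simp [Complex.cpow_eq_zero_iff, h0]
  rw [one_div, ← mul_assoc, mul_inv_cancel₀ this, one_mul]

lemma T4_S {s : ℂ} (hs : 0 < s.re) : T2 s⁻¹ = s ^ (1/2 : ℂ) * T4 s := by
  have h0 := ne0 hs
  have e := jacobiTheta₂_functional_equation (1/2) (I * s)
  have a1 : -I * (I * s) = s := by linear_combination (-s) * I_sq
  have a2 : -1 / (I * s) = I * s⁻¹ := by field_simp; linear_combination - I_sq
  have a3 : (1/2) / (I * s) = - ((1/2) * (I * s⁻¹)) := by field_simp; linear_combination I_sq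
  rw [a1, a2, a3, jacobiTheta₂_neg_left] at e
  have h1 := PS_eq_jacobia 0 s
  have h2 := PS_eq_jacobi1 (1/2) s⁻¹
  simp at h1 h2 
  unfold T2 T4
  norm_num at e ⊢
  norm_num at h2
  rw [← one_div] at h1
  rw [h1, h2, e]
  have h5 : s ^ (1/2 : ℂ) ≠ 0 := by simp [Complex.cpow_eq_zero_iff, h0]
  have : cexp (-(π * (1/4) * s⁻¹)) = cexp (-(π * I * (1/4)) / (I * s)) := by
    congr 1; field_simp
  rw [this]
  rw [mul_assoc (s ^ (1/2 : ℂ))⁻¹, mul_inv_cancel_left₀ h5]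

lemma T2_S {s : ℂ} (hs : 0 < s.re) : T4 s⁻¹ = s ^ (1/2 : ℂ) * T2 s := by
  have := T4_S (inv_re_pos hs)
  rw [inv_inv] at this
  have h0 := ne0 hs
  have h2 : s ^ (1/2 : ℂ) * s⁻¹ ^ (1/2 : ℂ) = 1 := by
    rw [Complex.inv_cpow, mul_inv_cancel₀]
    · simp [Complex.cpow_eq_zero_iff, h0]
    · intro h
      have := Complex.arg_eq_pi_iff.mp h
      linarith [this.1]
  rw [this, ← mul_assoc, h2, one_mul]

lemma F1_S {s : ℂ} (hs : 0 < s.re) : F1 s⁻¹ = s * s ^ (1/2 : ℂ) * F1 s := by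
  have h0 := ne0 hs
  have e := jacobiTheta₂'_functional_equation (1/2 + (1/2) * (I * s)) (I * s)
  have a1 : -I * (I * s) = s := by linear_combination (-s) * I_sq
  have a2 : -1 / (I * s) = I * s⁻¹ := by field_simp; linear_combination - I_sq
  have a3 : (1/2 + (1/2) * (I * s)) / (I * s) = 1/2 + (-(1/2)) * (I * s⁻¹) := by
    field_simp; linear_combination I_sq
  rw [a1, a2, a3] at e
  have h1 := PS_eq_jacobi' (1/2) hs
  have h2 := PS_eq_jacobi' (-(1/2)) (inv_re_pos hs)
  have h3 := PS_eq_jacobia (-(1/2)) s⁻¹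
  have h4 : PS ca (-(1/2)) s⁻¹ = 0 := by
    rw [PS_neg]; simp only [ca_neg]; exact PS_ca_half _
  rw [h4] at h3
  have h3' : jacobiTheta₂ (1/2 + (-(1/2)) * (I * s⁻¹)) (I * s⁻¹) = 0 := by
    have := (mul_eq_zero.mp h3.symm).resolve_left (Complex.exp_ne_zero _)
    push_cast at this
    exact this
  rw [h3', mul_zero, sub_zero] at e
  push_cast at h1 h2
  rw [e] at h1
  rw [F1_eq hs, F1_eq' (inv_re_pos hs)]
  have hp : (2 * π * I : ℂ) ≠ 0 := by simp [pi_ne_zero]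
  have hne : s ^ (1/2 : ℂ) ≠ 0 := by simp [Complex.cpow_eq_zero_iff, h0]
  apply mul_left_cancel₀ hp
  set J := jacobiTheta₂' (1/2 + (-(1/2)) * (I * s⁻¹)) (I * s⁻¹) with hJ
  rw [show 2 * π * I * (-2 * PS (fun n => ca n * n) (-(1/2)) s⁻¹) =
     -2 * (2 * π * I * PS (fun n => ca n * n) (-(1/2)) s⁻¹) by ring, h2,
    show 2 * π * I * (s * s ^ (1/2:ℂ) * (2 * PS (fun n => ca n * n) (1/2) s)) =
     2 * s * s ^ (1/2:ℂ) * (2 * π * I * PS (fun n => ca n * n) (1/2) s) by ring, h1]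
  have e3 : cexp (-(π * (1/2)^2) * s) * cexp (-π * I * (1/2 + 1/2 * (I * s)) ^ 2 / (I * s)) =
      -I * cexp (-(π * (-(1/2))^2) * s⁻¹) := by
    rw [← Complex.exp_add]
    have : -I = cexp (-(π/2) * I) := by
      rw [Complex.exp_mul_I]; simp [Complex.cos_neg, Complex.sin_neg]
    rw [this, ← Complex.exp_add]
    congr 1
    field_simp
    linear_combination (- s^2) * I_sq 
  rw [show 2 * s * s ^ (1/2:ℂ) * (cexp (-(π * (1/2)^2) * s) * (1 / s ^ (1/2:ℂ) * cexp (-π * I * (1/2 + 1/2 * (I * s)) ^ 2 / (I * s)) / (I * s) * J)) = 2 * s * s ^ (1/2:ℂ) * (cexp (-(π * (1/2)^2) * s) * cexp (-π * I * (1/2 + 1/2 * (I * s)) ^ 2 / (I * s))) / (s ^ (1/2:ℂ) * (I * s)) * J by field_simp, e3]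
  field_simp

set_option linter.unusedSimpArgs false

lemma r3_sq {y : ℝ} (hy : 0 < y) : r3 y ^ 2 = r3 (2 * y) ^ 2 + r2 (2 * y) ^ 2 := by
  have := T3_sq (s := (y:ℂ)) (by simpa using hy)
  rw [show (2:ℂ) * (y:ℂ) = ((2 * y : ℝ) : ℂ) by push_cast; ring] at this
  simp only [T3r, T2r, T4r] at this
  exact_mod_cast this
lemma r4_sq {y : ℝ} (hy : 0 < y) : r4 y ^ 2 = r3 (2 * y) ^ 2 - r2 (2 * y) ^ 2 := by
  have := T4_sq (s := (y:ℂ)) (by simpa using hy)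
  rw [show (2:ℂ) * (y:ℂ) = ((2 * y : ℝ) : ℂ) by push_cast; ring] at this
  simp only [T3r, T2r, T4r] at this
  exact_mod_cast this
lemma r3_r4 {y : ℝ} (hy : 0 < y) : r3 y * r4 y = r4 (2 * y) ^ 2 := by
  have := T3_T4 (s := (y:ℂ)) (by simpa using hy)
  rw [show (2:ℂ) * (y:ℂ) = ((2 * y : ℝ) : ℂ) by push_cast; ring] at this
  simp only [T3r, T2r, T4r] at this
  exact_mod_cast this
lemma r2_sq {y : ℝ} (hy : 0 < y) : r2 y ^ 2 = 2 * r2 (2 * y) * r3 (2 * y) := by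
  have := T2_sq (s := (y:ℂ)) (by simpa using hy)
  rw [show (2:ℂ) * (y:ℂ) = ((2 * y : ℝ) : ℂ) by push_cast; ring] at this
  simp only [T3r, T2r, T4r] at this
  exact_mod_cast this
lemma r_jacobi {y : ℝ} (hy : 0 < y) : r3 y ^ 4 = r2 y ^ 4 + r4 y ^ 4 := by
  have := T_jacobi (s := (y:ℂ)) (by simpa using hy)
  simp only [T3r, T2r, T4r] at this
  exact_mod_cast this

lemma ofReal_cpow_half {y : ℝ} (hy : 0 < y) : (y:ℂ) ^ (1/2 : ℂ) = ((√y : ℝ) : ℂ) := by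
  rw [Real.sqrt_eq_rpow, Complex.ofReal_cpow hy.le]; norm_num

lemma r3_S {y : ℝ} (hy : 0 < y) : r3 y⁻¹ = √y * r3 y := by
  have := T3_S (s := (y:ℂ)) (by simpa using hy)
  rw [ofReal_cpow_half hy, ← Complex.ofReal_inv] at this
  simp only [T3r, T2r, T4r] at this
  exact_mod_cast this
lemma r4_S {y : ℝ} (hy : 0 < y) : r4 y⁻¹ = √y * r2 y := by
  have := T2_S (s := (y:ℂ)) (by simpa using hy)
  rw [ofReal_cpow_half hy, ← Complex.ofReal_inv] at this
  simp only [T3r, T2r, T4r] at this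
  exact_mod_cast this
lemma r2_S {y : ℝ} (hy : 0 < y) : r2 y⁻¹ = √y * r4 y := by
  have := T4_S (s := (y:ℂ)) (by simpa using hy)
  rw [ofReal_cpow_half hy, ← Complex.ofReal_inv] at this
  simp only [T3r, T2r, T4r] at this
  exact_mod_cast this

lemma r3_pos {y : ℝ} (hy : 0 < y) : 0 < r3 y := by
  unfold r3 PR
  exact (B1.summableR 0 hy).tsum_pos (fun n => by simp only [c1]; positivity) 0 (by simp [c1])
lemma r2_pos {y : ℝ} (hy : 0 < y) : 0 < r2 y := by
  unfold r2 PR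
  exact (B1.summableR (1/2) hy).tsum_pos (fun n => by simp only [c1]; positivity) 0
    (by simp only [c1]; positivity)
lemma r4_pos {y : ℝ} (hy : 0 < y) : 0 < r4 y := by
  have := r4_S (inv_pos.mpr hy)
  rw [inv_inv] at this
  rw [this]
  have := r2_pos (inv_pos.mpr hy)
  positivity

lemma int_sq_lem (n : ℤ) : ((n:ℝ) + 1/2) ^ 2 = 1/4 ↔ n = 0 ∨ n = -1 := by
  constructor
  · intro h
    have h2 : (n:ℝ) * (n + 1) = 0 := by nlinarith
    rcases mul_eq_zero.mp h2 with h | h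
    · left; exact_mod_cast h
    · right
      have : n + 1 = 0 := by exact_mod_cast h
      omega
  · rintro (rfl | rfl) <;> norm_num
lemma int_sq_ge (n : ℤ) : 1/4 ≤ ((n:ℝ) + 1/2) ^ 2 := by
  have : 0 ≤ n * (n + 1) := by
    rcases le_or_gt 0 n with h | h
    · positivity
    · nlinarith
  have : (0:ℝ) ≤ n * (n + 1) := by exact_mod_cast this
  nlinarith
lemma int_sq1 (n : ℤ) : ((n:ℝ) + 0) ^ 2 = 1 ↔ n = 1 ∨ n = -1 := by
  rw [add_zero]
  constructor
  · intro h
    have : n ^ 2 = 1 := by exact_mod_cast h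
    have h3 : (n - 1) * (n + 1) = 0 := by nlinarith
    rcases mul_eq_zero.mp h3 with h | h <;> omega
  · rintro (rfl | rfl) <;> norm_num

lemma tsum_half (c : ℤ → ℝ) : (∑' n : ℤ, if ((n:ℝ) + 1/2) ^ 2 = 1/4 then c n else 0) = c 0 + c (-1) := by
  rw [tsum_eq_sum (s := {0, -1})]
  · rw [Finset.sum_pair (by norm_num)]; simp only [int_sq_lem]; simp
  · intro n hn
    rw [if_neg]
    rw [int_sq_lem]; simpa using hn
lemma tsum_one' (c : ℤ → ℝ) : (∑' n : ℤ, if ((n:ℝ) + 0) ^ 2 = 1 then c n else 0) = c 1 + c (-1) := by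
  rw [tsum_eq_sum (s := {1, -1})]
  · rw [Finset.sum_pair (by norm_num)]; simp only [int_sq1]; simp
  · intro n hn
    rw [if_neg]
    rw [int_sq1]; simpa using hn
lemma tsum_zero' (c : ℤ → ℝ) : (∑' n : ℤ, if ((n:ℝ) + 0) ^ 2 = 0 then c n else 0) = c 0 := by
  rw [tsum_eq_single 0]
  · simp
  · intro n hn; simp [hn]

lemma r3_lim : Filter.Tendsto r3 Filter.atTop (nhds 1) := by
  have := B1.tendstoR 0 0 (fun n _ => by positivity)
  rw [tsum_zero'] at this
  simp only [mul_zero, zero_mul, Real.exp_zero, one_mul] at this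
  exact this
lemma r4_lim : Filter.Tendsto r4 Filter.atTop (nhds 1) := by
  have := Ba.tendstoR 0 0 (fun n _ => by positivity)
  rw [tsum_zero'] at this
  simp only [mul_zero, zero_mul, Real.exp_zero, one_mul] at this
  rw [show ca 0 = 1 from zpow_zero _] at this
  exact this
lemma r2_lim : Filter.Tendsto (fun y => rexp (π * (1/4) * y) * r2 y) Filter.atTop (nhds 2) := by
  have := B1.tendstoR (1/2) (1/4) (fun n _ => int_sq_ge n)
  rw [tsum_half] at this
  simp only [c1] at this
  norm_num at this ⊢
  exact this

noncomputable def r3' : ℝ → ℝ := PR (fun n => c1 n * -(π * (n + 0) ^ 2)) 0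
noncomputable def r4' : ℝ → ℝ := PR (fun n => ca n * -(π * (n + 0) ^ 2)) 0
noncomputable def r2' : ℝ → ℝ := PR (fun n => c1 n * -(π * (n + 1/2) ^ 2)) (1/2)
lemma r3_deriv {y : ℝ} (hy : 0 < y) : HasDerivAt r3 (r3' y) y := B1.hasDerivAtR 0 hy
lemma r4_deriv {y : ℝ} (hy : 0 < y) : HasDerivAt r4 (r4' y) y := Ba.hasDerivAtR 0 hy
lemma r2_deriv {y : ℝ} (hy : 0 < y) : HasDerivAt r2 (r2' y) y := B1.hasDerivAtR (1/2) hy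

lemma int_sq_one_le {n : ℤ} (h : n ≠ 0) : (1:ℝ) ≤ (n + 0) ^ 2 := by
  rw [add_zero]
  have : 0 < n ^ 2 := by positivity
  have : 1 ≤ n ^ 2 := this
  exact_mod_cast this

lemma r3'_lim : Filter.Tendsto (fun y => rexp (π * y) * r3' y) Filter.atTop (nhds (-2 * π)) := by
  have := (B1.mul (polyB_sq 0)).tendstoR 0 1 (fun n hn => int_sq_one_le (by rintro rfl; simp at hn))
  rw [tsum_one'] at this
  simp only [c1] at this
  convert this using 2
  · rw [mul_one]; rfl
  · push_cast; ring
lemma r4'_lim : Filter.Tendsto (fun y => rexp (π * y) * r4' y) Filter.atTop (nhds (2 * π)) := by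
  have := (Ba.mul (polyB_sq 0)).tendstoR 0 1 (fun n hn => int_sq_one_le (by rintro rfl; simp at hn))
  rw [tsum_one'] at this
  simp only [ca_neg, ca_one] at this
  convert this using 2
  · rw [mul_one]; rfl
  · push_cast; ring

noncomputable def DD (y : ℝ) : ℝ := (r4' y / r4 y - r3' y / r3 y) / r2 y ^ 4

lemma DD_double {y : ℝ} (hy : 0 < y) : DD (2 * y) = DD y := by
  have hy2 : 0 < 2 * y := by positivity
  have h3 := r3_pos hy
  have h4 := r4_pos hy
  have h2 := r2_pos hy
  have H3 := r3_pos hy2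
  have H4 := r4_pos hy2
  have H2 := r2_pos hy2
  have e1 : 2 * r3 (2 * y) ^ 2 = r3 y ^ 2 + r4 y ^ 2 := by linarith [r3_sq hy, r4_sq hy]
  have e2 : r4 (2 * y) ^ 2 = r3 y * r4 y := (r3_r4 hy).symm
  have e3 : 2 * r2 (2 * y) ^ 2 = r3 y ^ 2 - r4 y ^ 2 := by linarith [r3_sq hy, r4_sq hy]
  have e4 : r2 y ^ 4 = r3 y ^ 4 - r4 y ^ 4 := by linarith [r_jacobi hy]
  have hlin : HasDerivAt (fun y : ℝ => 2 * y) 2 y := by simpa using (hasDerivAt_id y).const_mul 2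
  have d3 : HasDerivAt (fun y => r3 (2 * y)) (r3' (2 * y) * 2) y := (r3_deriv hy2).comp y hlin
  have d4 : HasDerivAt (fun y => r4 (2 * y)) (r4' (2 * y) * 2) y := (r4_deriv hy2).comp y hlin
  have ev : ∀ᶠ z in nhds y, 0 < z := lt_mem_nhds hy
  have k1 : 4 * r3 (2 * y) * (r3' (2 * y) * 2) = 2 * r3 y * r3' y + 2 * r4 y * r4' y := by
    have a := (d3.pow 2).const_mul 2
    have b := ((r3_deriv hy).pow 2).add ((r4_deriv hy).pow 2)
    have c := b.congr_of_eventuallyEq (f₁ := fun y => 2 * r3 (2 * y) ^ 2) (by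
      filter_upwards [ev] with z hz
      simp; linarith [r3_sq hz, r4_sq hz])
    have := a.unique c
    simp at this; linarith
  have k2 : 2 * r4 (2 * y) * (r4' (2 * y) * 2) = r3 y * r4' y + r3' y * r4 y := by
    have a := d4.pow 2
    have b := (r3_deriv hy).mul (r4_deriv hy)
    have c := b.congr_of_eventuallyEq (f₁ := (fun y => r4 (2 * y)) ^ 2) (by
      filter_upwards [ev] with z hz
      simp; linarith [r3_r4 hz])
    have := a.unique c
    simp at this; linarith
  have hlt : r4 y ^ 2 < r3 y ^ 2 := by have : 0 < r2 (2 * y) ^ 2 := by positivity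
                                       linarith
  unfold DD
  have l3 : r3' (2 * y) / r3 (2 * y) = (r3 y * r3' y + r4 y * r4' y) / (2 * (r3 y ^ 2 + r4 y ^ 2)) := by
    rw [← e1]; field_simp; linarith
  have l4 : r4' (2 * y) / r4 (2 * y) = (r3 y * r4' y + r3' y * r4 y) / (4 * (r3 y * r4 y)) := by
    rw [← e2]; field_simp; linarith
  have l2 : r2 (2 * y) ^ 4 = (r3 y ^ 2 - r4 y ^ 2) ^ 2 / 4 := by rw [← e3]; ring
  have p1 : 0 < r3 y ^ 2 - r4 y ^ 2 := by linarith
  have p2 : r3 y ^ 4 - r4 y ^ 4 = (r3 y ^ 2 - r4 y ^ 2) * (r3 y ^ 2 + r4 y ^ 2) := by ring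
  rw [l3, l4, l2, e4, p2]
  have p3 : 0 < r3 y ^ 2 + r4 y ^ 2 := by positivity
  field_simp
  ring

lemma DD_lim : Filter.Tendsto DD Filter.atTop (nhds (π / 4)) := by
  have h := ((r4'_lim.div r4_lim one_ne_zero).sub (r3'_lim.div r3_lim one_ne_zero)).div (r2_lim.pow 4)
    (by norm_num)
  have e : (2 * π / 1 - -2 * π / 1) / 2 ^ 4 = π / 4 := by ring
  rw [e] at h
  refine h.congr fun y => ?_
  simp only [Pi.div_apply, Pi.pow_apply]
  unfold DD
  rw [mul_pow, ← Real.exp_nat_mul]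
  have : (4:ℕ) * (π * (1/4) * y) = π * y := by push_cast; ring
  rw [this, mul_div_assoc, mul_div_assoc, ← mul_sub, mul_div_mul_left _ _ (Real.exp_ne_zero _)]

lemma const_of_double {f : ℝ → ℝ} {L : ℝ} (h : ∀ y, 0 < y → f (2 * y) = f y)
    (hl : Filter.Tendsto f Filter.atTop (nhds L)) {y : ℝ} (hy : 0 < y) : f y = L := by
  have h1 : ∀ n : ℕ, f (2 ^ n * y) = f y := by
    intro n
    induction n with
    | zero => simp
    | succ n ih => rw [pow_succ', mul_assoc, h _ (by positivity), ih]
  have h2 : Filter.Tendsto (fun n : ℕ => (2:ℝ) ^ n * y) Filter.atTop Filter.atTop :=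
    (tendsto_pow_atTop_atTop_of_one_lt one_lt_two).atTop_mul_const hy
  have h3 := hl.comp h2
  refine tendsto_nhds_unique (tendsto_const_nhds.congr fun n => ?_) h3
  exact (h1 n).symm

lemma r_wronskian {y : ℝ} (hy : 0 < y) : r4' y * r3 y - r3' y * r4 y = π / 4 * r2 y ^ 4 * r3 y * r4 y := by
  have := const_of_double (fun y hy => DD_double hy) DD_lim hy
  unfold DD at this
  have h3 := r3_pos hy
  have h4 := r4_pos hy
  have h2 := r2_pos hy
  field_simp at this
  linarith


noncomputable def II (a b : ℝ) : ℝ := ∫ x in Set.Ioi (0:ℝ), 1 / √((x ^ 2 + a ^ 2) * (x ^ 2 + b ^ 2))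

lemma tan_image {b : ℝ} (hb : 0 < b) : (fun θ => b * Real.tan θ) '' Set.Ioo 0 (π/2) = Set.Ioi 0 := by
  ext x
  simp only [Set.mem_image, Set.mem_Ioo, Set.mem_Ioi]
  constructor
  · rintro ⟨θ, ⟨h1, h2⟩, rfl⟩
    have := Real.tan_pos_of_pos_of_lt_pi_div_two h1 h2
    positivity
  · intro hx
    refine ⟨Real.arctan (x / b), ⟨?_, Real.arctan_lt_pi_div_two _⟩, ?_⟩
    · rw [Real.arctan_pos]; positivity
    · rw [Real.tan_arctan]; field_simp

lemma ellipticK_eq {k b : ℝ} (hb : 0 < b) (h : b ^ 2 = 1 - k ^ 2) : ellipticK k = II 1 b := by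
  unfold II ellipticK
  rw [← tan_image hb, intervalIntegral.integral_of_le (by positivity), integral_Ioc_eq_integral_Ioo]
  rw [integral_image_eq_integral_abs_deriv_smul (f' := fun θ => b * (1 / Real.cos θ ^ 2)) measurableSet_Ioo]
  · refine setIntegral_congr_fun measurableSet_Ioo fun θ hθ => ?_
    have hc : 0 < Real.cos θ := Real.cos_pos_of_mem_Ioo ⟨by linarith [hθ.1, pi_pos], hθ.2⟩
    have hs := Real.sin_sq_add_cos_sq θ
    have hpos : 0 < 1 - k ^ 2 * Real.sin θ ^ 2 := by
      have : 1 - k ^ 2 * Real.sin θ ^ 2 = Real.cos θ ^ 2 + b ^ 2 * Real.sin θ ^ 2 := by rw [h]; linear_combination -hs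
      rw [this]; positivity
    have e : ((b * Real.tan θ) ^ 2 + 1 ^ 2) * ((b * Real.tan θ) ^ 2 + b ^ 2) =
        (b / Real.cos θ ^ 2) ^ 2 * (1 - k ^ 2 * Real.sin θ ^ 2) := by
      rw [Real.tan_eq_sin_div_cos]
      have e1 : (b * (Real.sin θ / Real.cos θ)) ^ 2 + 1 ^ 2 = (1 - k ^ 2 * Real.sin θ ^ 2) / Real.cos θ ^ 2 := by
        field_simp; rw [h]; linear_combination hs
      have e2 : (b * (Real.sin θ / Real.cos θ)) ^ 2 + b ^ 2 = b ^ 2 / Real.cos θ ^ 2 := by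
        field_simp; linear_combination hs
      rw [e1, e2]; field_simp
    simp only [smul_eq_mul]
    rw [e, Real.sqrt_mul (by positivity), Real.sqrt_sq (by positivity), Real.rpow_neg hpos.le, ← Real.sqrt_eq_rpow,
      abs_of_pos (by positivity)]
    have := Real.sqrt_pos.mpr hpos
    field_simp
  · intro θ hθ
    have hc : 0 < Real.cos θ := Real.cos_pos_of_mem_Ioo ⟨by linarith [hθ.1, pi_pos], hθ.2⟩
    exact ((Real.hasDerivAt_tan hc.ne').const_mul b).hasDerivWithinAt
  · intro x hx y hy hxy
    have := mul_left_cancel₀ hb.ne' hxy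
    exact Real.tan_inj_of_lt_of_lt_pi_div_two (by linarith [hx.1, pi_pos]) hx.2 (by linarith [hy.1, pi_pos]) hy.2 this

lemma II_scale {a b c : ℝ} (hc : 0 < c) : II (c * a) (c * b) = c⁻¹ * II a b := by
  unfold II
  have := integral_comp_mul_left_Ioi (fun x => 1 / √((x ^ 2 + (c*a) ^ 2) * (x ^ 2 + (c*b) ^ 2))) 0 hc
  rw [mul_zero, smul_eq_mul] at this
  have h2 : ∀ x : ℝ, 1 / √(((c * x) ^ 2 + (c*a) ^ 2) * ((c * x) ^ 2 + (c*b) ^ 2)) =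
      (c⁻¹ * c⁻¹) * (1 / √((x ^ 2 + a ^ 2) * (x ^ 2 + b ^ 2))) := by
    intro x
    rw [show ((c * x) ^ 2 + (c*a) ^ 2) * ((c * x) ^ 2 + (c*b) ^ 2) =
      (c ^ 2) ^ 2 * ((x ^ 2 + a ^ 2) * (x ^ 2 + b ^ 2)) by ring, Real.sqrt_mul (by positivity),
      Real.sqrt_sq (by positivity)]
    rw [one_div, mul_inv]; ring
  simp_rw [h2] at this
  rw [MeasureTheory.integral_const_mul, mul_assoc] at this
  exact (mul_left_cancel₀ (by positivity) this).symm

lemma uv_image {c : ℝ} (hc : 0 < c) : (fun x => (x - c / x) / 2) '' Set.Ioi 0 = Set.univ := by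
  ext u
  simp only [Set.mem_image, Set.mem_Ioi, Set.mem_univ, iff_true]
  have hs : √(u ^ 2 + c) ^ 2 = u ^ 2 + c := Real.sq_sqrt (by positivity)
  have h1 : |u| < √(u ^ 2 + c) := by
    rw [← Real.sqrt_sq_eq_abs]; exact Real.sqrt_lt_sqrt (by positivity) (by linarith)
  have h2 : 0 < u + √(u ^ 2 + c) := by linarith [neg_abs_le u]
  refine ⟨u + √(u ^ 2 + c), h2, ?_⟩
  field_simp
  linear_combination hs

lemma uv_subst {c : ℝ} (hc : 0 < c) (g : ℝ → ℝ) :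
    ∫ u, g u = ∫ x in Set.Ioi (0:ℝ), (1 + c / x ^ 2) / 2 * g ((x - c / x) / 2) := by
  rw [← setIntegral_univ, ← uv_image hc,
    integral_image_eq_integral_abs_deriv_smul (f' := fun x => (1 + c / x ^ 2) / 2) measurableSet_Ioi]
  · refine setIntegral_congr_fun measurableSet_Ioi fun x hx => ?_
    have hx : 0 < x := hx
    simp only [smul_eq_mul]
    rw [abs_of_pos (by positivity)]
  · intro x hx
    have hx : 0 < x := hx
    have h1 := ((hasDerivAt_id x).sub ((hasDerivAt_inv hx.ne').const_mul c)).div_const 2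
    have h2 : HasDerivAt (fun x => (x - c / x) / 2) ((1 + c / x ^ 2) / 2) x := by
      refine (h1.congr_deriv ?_).congr_of_eventuallyEq (Filter.Eventually.of_forall fun z => ?_)
      · field_simp; ring
      · simp [div_eq_mul_inv]
    exact h2.hasDerivWithinAt
  · intro x hx y hy hxy
    have hx : 0 < x := hx
    have hy : 0 < y := hy
    simp only at hxy
    field_simp at hxy
    have : (x - y) * (x * y + c) = 0 := by linear_combination hxy
    have h := (mul_eq_zero.mp this).resolve_right (by positivity)
    linarith

lemma II_full (a b : ℝ) : ∫ x : ℝ, 1 / √((x ^ 2 + a ^ 2) * (x ^ 2 + b ^ 2)) = 2 * II a b := by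
  rw [II, ← integral_comp_abs]
  simp

lemma II_landen {a b : ℝ} (ha : 0 < a) (hb : 0 < b) : II ((a + b) / 2) (√(a * b)) = II a b := by
  have h := II_full ((a + b) / 2) (√(a * b))
  rw [Real.sq_sqrt (by positivity), uv_subst (c := a * b) (by positivity)] at h
  have e : ∀ x ∈ Set.Ioi (0:ℝ), (1 + a * b / x ^ 2) / 2 *
      (1 / √((((x - a * b / x) / 2) ^ 2 + ((a + b) / 2) ^ 2) * (((x - a * b / x) / 2) ^ 2 + a * b))) =
      2 * (1 / √((x ^ 2 + a ^ 2) * (x ^ 2 + b ^ 2))) := by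
    intro x hx
    have hx : 0 < x := hx
    have e1 : (((x - a * b / x) / 2) ^ 2 + ((a + b) / 2) ^ 2) * (((x - a * b / x) / 2) ^ 2 + a * b) =
      ((1 + a * b / x ^ 2) / 4) ^ 2 * ((x ^ 2 + a ^ 2) * (x ^ 2 + b ^ 2)) := by field_simp; ring
    have : 0 < √((x ^ 2 + a ^ 2) * (x ^ 2 + b ^ 2)) := by positivity
    rw [e1, Real.sqrt_mul (by positivity), Real.sqrt_sq (by positivity)]
    field_simp; norm_num
  rw [setIntegral_congr_fun measurableSet_Ioi e, MeasureTheory.integral_const_mul] at h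
  exact (mul_left_cancel₀ two_ne_zero h).symm

lemma int_inv_sq : ∫ x in Set.Ioi (0:ℝ), 1 / (x ^ 2 + 1) = π / 2 := by
  have := integral_Ioi_inv_one_add_sq (i := 0)
  simp only [Real.arctan_zero, sub_zero] at this
  rw [← this]
  congr 1; ext x; rw [one_div, add_comm]

lemma II_diag {a : ℝ} (ha : 0 < a) : II a a = π / (2 * a) := by
  have h : II 1 1 = π / 2 := by
    rw [← int_inv_sq, II]
    congr 1; ext x
    rw [← sq, Real.sqrt_sq (by positivity)]; simp
  have := II_scale (a := 1) (b := 1) ha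
  rw [mul_one, h] at this
  rw [this]; field_simp

lemma int_diag {a : ℝ} (ha : 0 < a) : IntegrableOn (fun x : ℝ => 1 / √((x ^ 2 + a ^ 2) * (x ^ 2 + a ^ 2))) (Set.Ioi 0) := by
  apply Integrable.integrableOn
  have := (integrable_inv_one_add_sq.comp_mul_left' (R := a⁻¹) (by positivity)).const_mul (a⁻¹ ^ 2)
  refine this.congr (Filter.Eventually.of_forall fun x => ?_)
  simp only
  rw [← sq, Real.sqrt_sq (by positivity)]
  field_simp
  ring

lemma II_le {a b a' b' : ℝ} (ha : 0 < a) (hb : 0 < b) (h : a ≤ a') (h' : b ≤ b') (hi : IntegrableOn (fun x : ℝ => 1 / √((x ^ 2 + a ^ 2) * (x ^ 2 + b ^ 2))) (Set.Ioi 0))  : II a' b' ≤ II a b := by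
  unfold II
  apply integral_mono_of_nonneg (Filter.Eventually.of_forall fun x => by positivity) hi
  refine Filter.Eventually.of_forall fun x => ?_
  simp only
  apply one_div_le_one_div_of_le
  · positivity
  · apply Real.sqrt_le_sqrt; gcongr

lemma int_gen {a b : ℝ} (hb : 0 < b) (h : b ≤ a) : IntegrableOn (fun x : ℝ => 1 / √((x ^ 2 + a ^ 2) * (x ^ 2 + b ^ 2))) (Set.Ioi 0) := by
  have ha := hb.trans_le h
  refine (int_diag hb).mono' ?_ ?_
  · apply Continuous.aestronglyMeasurable
    apply Continuous.div continuous_const (by fun_prop)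
    intro x; positivity
  · refine Filter.Eventually.of_forall fun x => ?_
    rw [Real.norm_eq_abs, abs_of_nonneg (by positivity)]
    apply one_div_le_one_div_of_le
    · positivity
    · apply Real.sqrt_le_sqrt; gcongr

lemma II_theta {y : ℝ} (hy : 0 < y) : II (r3 y ^ 2) (r4 y ^ 2) = π / 2 := by
  refine const_of_double (f := fun y => II (r3 y ^ 2) (r4 y ^ 2)) ?_ ?_ hy
  · intro y hy
    have h3 := r3_pos hy
    have h4 := r4_pos hy
    have e1 : r3 (2 * y) ^ 2 = (r3 y ^ 2 + r4 y ^ 2) / 2 := by linarith [r3_sq hy, r4_sq hy]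
    have e2 : r4 (2 * y) ^ 2 = √(r3 y ^ 2 * r4 y ^ 2) := by
      rw [← mul_pow, Real.sqrt_sq (by positivity), r3_r4 hy]
    rw [e1, e2, II_landen (by positivity) (by positivity)]
  · have l3 : Filter.Tendsto (fun y => π / (2 * r3 y ^ 2)) Filter.atTop (nhds (π / 2)) := by
      have := (tendsto_const_nhds (x := π)).div ((r3_lim.pow 2).const_mul 2) (by norm_num)
      rw [one_pow, mul_one] at this
      exact this
    have l4 : Filter.Tendsto (fun y => π / (2 * r4 y ^ 2)) Filter.atTop (nhds (π / 2)) := by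
      have := (tendsto_const_nhds (x := π)).div ((r4_lim.pow 2).const_mul 2) (by norm_num)
      rw [one_pow, mul_one] at this
      exact this
    refine tendsto_of_tendsto_of_tendsto_of_le_of_le' l3 l4 ?_ ?_
    all_goals
      filter_upwards [Filter.eventually_gt_atTop 0] with y hy
      have h3 := r3_pos hy
      have h4 := r4_pos hy
      have hle : r4 y ^ 2 ≤ r3 y ^ 2 := by
        have := r3_sq hy
        have := r4_sq hy
        nlinarith [sq_nonneg (r2 (2 * y))]
    · rw [← II_diag (by positivity)]
      exact II_le (by positivity) (by positivity) le_rfl hle (int_gen (by positivity) hle)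
    · rw [← II_diag (by positivity)]
      exact II_le (by positivity) (by positivity) hle le_rfl (int_diag (by positivity))

lemma K_theta {y : ℝ} (hy : 0 < y) :
    ellipticK (√(r4 y ^ 4 / r3 y ^ 4)) = π / 2 * y * r3 y ^ 2 := by
  have h3 := r3_pos hy
  have h2 := r2_pos hy
  have h4 := r4_pos hy
  have hb : 0 < r2 y ^ 2 / r3 y ^ 2 := by positivity
  rw [ellipticK_eq hb]
  · have := II_theta (inv_pos.mpr hy)
    have s2 : √y ^ 2 = y := Real.sq_sqrt hy.le
    rw [r3_S hy, r4_S hy, mul_pow, mul_pow, s2] at this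
    have e : II (y * r3 y ^ 2) (y * r2 y ^ 2) = (y * r3 y ^ 2)⁻¹ * II 1 (r2 y ^ 2 / r3 y ^ 2) := by
      rw [← II_scale (by positivity)]; congr 1 <;> field_simp
    rw [e] at this
    field_simp at this
    linarith
  · rw [Real.sq_sqrt (by positivity)]
    have := r_jacobi hy
    field_simp
    linarith

lemma r_one : r2 1 = r4 1 := by
  have := r4_S one_pos
  simp at this; exact this.symm

lemma r3_one : r3 1 ^ 4 = 2 * r4 1 ^ 4 := by
  have := r_jacobi one_pos
  rw [r_one] at this; linarith

lemma lemniscate : ∫ x in Set.Ioi (0:ℝ), 1 / √(x ^ 4 + 1) = π / 2 * r3 1 ^ 2 := by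
  have h3 := r3_pos one_pos
  have h4 := r4_pos one_pos
  have h := II_theta one_pos
  have e : II (r3 1 ^ 2) (r4 1 ^ 2) = (r3 1 ^ 2)⁻¹ * II 1 (r4 1 ^ 2 / r3 1 ^ 2) := by
    rw [← II_scale (by positivity)]; congr 1 <;> field_simp
  rw [e] at h
  have h5 : II 1 (r4 1 ^ 2 / r3 1 ^ 2) = π / 2 * r3 1 ^ 2 := by field_simp at h; linarith
  rw [← h5]
  have hb : (r4 1 ^ 2 / r3 1 ^ 2) ^ 2 = 1 / 2 := by have := r3_one; field_simp; linarith
  have h := II_full 1 (r4 1 ^ 2 / r3 1 ^ 2)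
  rw [hb, uv_subst (c := 1) one_pos] at h
  have e : ∀ x ∈ Set.Ioi (0:ℝ), (1 + 1 / x ^ 2) / 2 *
      (1 / √((((x - 1 / x) / 2) ^ 2 + 1 ^ 2) * (((x - 1 / x) / 2) ^ 2 + 1 / 2))) =
      2 * (1 / √(x ^ 4 + 1)) := by
    intro x hx
    have hx : 0 < x := hx
    have e1 : (((x - 1 / x) / 2) ^ 2 + 1 ^ 2) * (((x - 1 / x) / 2) ^ 2 + 1 / 2) =
      ((1 + 1 / x ^ 2) / 4) ^ 2 * (x ^ 4 + 1) := by field_simp; ring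
    have : 0 < √(x ^ 4 + 1) := by positivity
    rw [e1, Real.sqrt_mul (by positivity), Real.sqrt_sq (by positivity)]
    field_simp; norm_num
  rw [setIntegral_congr_fun measurableSet_Ioi e, MeasureTheory.integral_const_mul] at h
  exact mul_left_cancel₀ two_ne_zero h

lemma beta_quarter : ∫ w in Set.Ioo (0:ℝ) 1, w ^ (-(3/4) : ℝ) * (1 - w) ^ (-(3/4) : ℝ) =
    Real.Gamma (1/4) ^ 2 / √π := by
  have h := ProbabilityTheory.beta_eq_betaIntegralReal (1/4) (1/4) (by norm_num) (by norm_num)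
  rw [ProbabilityTheory.beta] at h
  have e : (1/4 + 1/4 : ℝ) = 1/2 := by norm_num
  rw [e, Real.Gamma_one_half_eq, ← sq] at h
  rw [h, Complex.betaIntegral, intervalIntegral.integral_of_le zero_le_one, integral_Ioc_eq_integral_Ioo]
  have : ∀ x ∈ Set.Ioo (0:ℝ) 1, (x:ℂ) ^ (((1/4 : ℝ) : ℂ) - 1) * (1 - (x:ℂ)) ^ (((1/4 : ℝ) : ℂ) - 1) =
      ((x ^ (-(3/4) : ℝ) * (1 - x) ^ (-(3/4) : ℝ) : ℝ) : ℂ) := by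
    intro x hx
    rw [Complex.ofReal_mul, Complex.ofReal_cpow hx.1.le, Complex.ofReal_cpow (by linarith [hx.2])]
    push_cast
    norm_num
  rw [setIntegral_congr_fun measurableSet_Ioo this, integral_complex_ofReal, Complex.ofReal_re]

lemma q_image : (fun w : ℝ => (1/w - 1) ^ (1/4 : ℝ)) '' Set.Ioo 0 1 = Set.Ioi 0 := by
  ext x
  simp only [Set.mem_image, Set.mem_Ioo, Set.mem_Ioi]
  constructor
  · rintro ⟨w, ⟨h1, h2⟩, rfl⟩
    apply Real.rpow_pos_of_pos
    rw [sub_pos, lt_div_iff₀ h1]; linarith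
  · intro hx
    have h4 : 0 < x ^ 4 := by positivity
    refine ⟨1 / (1 + x ^ 4), ⟨by positivity, ?_⟩, ?_⟩
    · rw [div_lt_one (by positivity)]; linarith
    · rw [one_div_one_div, add_sub_cancel_left, ← Real.rpow_natCast, ← Real.rpow_mul hx.le]; norm_num

lemma lemniscate_gamma : ∫ x in Set.Ioi (0:ℝ), 1 / √(x ^ 4 + 1) = Real.Gamma (1/4) ^ 2 / (4 * √π) := by
  have hpos : ∀ w ∈ Set.Ioo (0:ℝ) 1, 0 < 1 / w - 1 := by
    intro w hw
    rw [sub_pos, lt_div_iff₀ hw.1]; linarith [hw.2]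
  rw [← q_image, integral_image_eq_integral_abs_deriv_smul
    (f' := fun w => (-(w ^ 2)⁻¹) * (1/4) * (1/w - 1) ^ ((1/4 : ℝ) - 1)) measurableSet_Ioo]
  · have e : ∀ w ∈ Set.Ioo (0:ℝ) 1, |(-(w ^ 2)⁻¹) * (1/4) * (1/w - 1) ^ ((1/4 : ℝ) - 1)| •
        (1 / √(((1/w - 1) ^ (1/4 : ℝ)) ^ 4 + 1)) = 1/4 * (w ^ (-(3/4) : ℝ) * (1 - w) ^ (-(3/4) : ℝ)) := by
      intro w hw
      have hp := hpos w hw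
      have hw0 := hw.1
      have hw1 : 0 < 1 - w := by linarith [hw.2]
      have e1 : ((1/w - 1) ^ (1/4 : ℝ)) ^ 4 + 1 = 1 / w := by
        rw [← Real.rpow_natCast, ← Real.rpow_mul hp.le]; norm_num
      have e2 : (1/w - 1) ^ ((1/4 : ℝ) - 1) = (1 - w) ^ (-(3/4) : ℝ) * w ^ (3/4 : ℝ) := by
        rw [show 1/w - 1 = (1 - w) / w by field_simp, Real.div_rpow hw1.le hw0.le, div_eq_mul_inv,
          ← Real.rpow_neg hw0.le]; norm_num
      have e3 : √(1/w) = w ^ (-(1/2) : ℝ) := by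
        rw [one_div, Real.sqrt_eq_rpow, Real.inv_rpow hw0.le, Real.rpow_neg hw0.le]
      have e4 : (w ^ 2)⁻¹ = w ^ (-2 : ℝ) := by
        rw [Real.rpow_neg hw0.le]; norm_num
      rw [e1, e2, e3, e4, smul_eq_mul, one_div (w ^ (-(1/2) : ℝ)), ← Real.rpow_neg hw0.le]
      have : 0 < w ^ (-2 : ℝ) * (1/4) * ((1 - w) ^ (-(3/4) : ℝ) * w ^ (3/4 : ℝ)) := by positivity
      rw [neg_mul, neg_mul, abs_neg, abs_of_pos this]
      have e5 : w ^ (-(3/4) : ℝ) = w ^ (-2 : ℝ) * w ^ (3/4 : ℝ) * w ^ (- -(1/2) : ℝ) := by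
        rw [← Real.rpow_add hw0, ← Real.rpow_add hw0]; norm_num
      rw [e5]; ring
    rw [setIntegral_congr_fun measurableSet_Ioo e, MeasureTheory.integral_const_mul, beta_quarter]
    ring
  · intro w hw
    have hp := hpos w hw
    have h1 : HasDerivAt (fun w : ℝ => 1/w - 1) (-(w^2)⁻¹) w := by
      simpa [one_div] using (hasDerivAt_inv hw.1.ne').sub_const 1
    exact (h1.rpow_const (Or.inl hp.ne')).hasDerivWithinAt
  · intro x hx y hy hxy
    have := (Real.rpow_left_inj (hpos x hx).le (hpos y hy).le (by norm_num)).mp hxy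
    have h2 : x⁻¹ = y⁻¹ := by simpa [one_div] using this
    exact inv_injective h2

lemma r3_one_gamma : r3 1 ^ 8 = Real.Gamma (1/4) ^ 8 / (16 * π ^ 6) := by
  have h := lemniscate.symm.trans lemniscate_gamma
  have hs : √π ^ 2 = π := Real.sq_sqrt pi_pos.le
  have hp := Real.sqrt_pos.mpr pi_pos
  have h2 : r3 1 ^ 2 = Real.Gamma (1/4) ^ 2 / (2 * π * √π) := by
    field_simp at h ⊢; linarith
  have : r3 1 ^ 8 = (r3 1 ^ 2) ^ 4 := by ring
  rw [this, h2, div_pow, mul_pow, show √π ^ 4 = (√π ^ 2) ^ 2 by ring, hs]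
  congr 1 <;> ring


noncomputable def tt (y : ℝ) : ℝ := r4 y ^ 4 / r3 y ^ 4

lemma one_sub_tt {y : ℝ} (hy : 0 < y) : 1 - tt y = r2 y ^ 4 / r3 y ^ 4 := by
  have := r_jacobi hy
  have := r3_pos hy
  unfold tt; field_simp; linarith

lemma tt_inv {y : ℝ} (hy : 0 < y) : tt y⁻¹ = 1 - tt y := by
  rw [one_sub_tt hy, tt, r4_S hy, r3_S hy, mul_pow, mul_pow, mul_div_mul_left]
  have := Real.sqrt_pos.mpr hy
  positivity

lemma tt_mem {y : ℝ} (hy : 0 < y) : tt y ∈ Set.Ioo (0:ℝ) 1 := by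
  have h3 := r3_pos hy
  have h2 := r2_pos hy
  have h4 := r4_pos hy
  refine ⟨by unfold tt; positivity, ?_⟩
  have := one_sub_tt hy
  have : 0 < r2 y ^ 4 / r3 y ^ 4 := by positivity
  linarith

lemma tt_deriv {y : ℝ} (hy : 0 < y) : HasDerivAt tt (π * r4 y ^ 4 * r2 y ^ 4 / r3 y ^ 4) y := by
  have h3 := r3_pos hy
  have := ((r4_deriv hy).pow 4).div ((r3_deriv hy).pow 4) (pow_ne_zero 4 h3.ne')
  refine this.congr_deriv ?_
  have w := r_wronskian hy
  simp only [Pi.pow_apply]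
  field_simp
  push_cast
  linear_combination (4 * r4 y ^ 3 * r3 y ^ 3) * w

lemma tt_lim : Filter.Tendsto tt Filter.atTop (nhds 1) := by
  have := (r4_lim.pow 4).div (r3_lim.pow 4) (by norm_num)
  rw [one_pow, div_one] at this
  exact this

lemma tt_image : tt '' Set.Ioi 0 = Set.Ioo 0 1 := by
  apply Set.Subset.antisymm
  · rintro _ ⟨y, hy, rfl⟩
    exact tt_mem hy
  · intro x hx
    have c : ContinuousOn tt (Set.Ioi 0) := fun y hy => (tt_deriv hy).continuousAt.continuousWithinAt
    obtain ⟨M, hM, hM0⟩ := ((tt_lim.eventually (lt_mem_nhds hx.2)).and (Filter.eventually_gt_atTop 0)).exists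
    obtain ⟨M', hM', hM0'⟩ := ((tt_lim.eventually (lt_mem_nhds (show 1 - x < 1 by linarith [hx.1]))).and
      (Filter.eventually_gt_atTop 0)).exists
    have h1 : tt M'⁻¹ < x := by rw [tt_inv hM0']; linarith
    exact isPreconnected_Ioi.intermediate_value (a := M'⁻¹) (b := M) (inv_pos.mpr hM0') hM0 c ⟨h1.le, hM.le⟩

lemma tt_inj : Set.InjOn tt (Set.Ioi 0) := by
  apply StrictMonoOn.injOn
  apply strictMonoOn_of_deriv_pos (convex_Ioi 0)
  · exact fun y hy => (tt_deriv hy).continuousAt.continuousWithinAt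
  · intro y hy
    rw [interior_Ioi] at hy
    have hy : 0 < y := hy
    rw [(tt_deriv hy).deriv]
    have h3 := r3_pos hy
    have h2 := r2_pos hy
    have h4 := r4_pos hy
    positivity

lemma pow_lem {a b c : ℝ} (ha : 0 < a) (hb : 0 < b) (hc : 0 < c) :
    a ^ 4 * b ^ 4 * c ^ 2 / ((a ^ 4 / c ^ 4 * (b ^ 4 / c ^ 4)) ^ ((1:ℝ)/6)) = (b * c * a) ^ ((10:ℝ)/3) := by
  have e : ∀ x : ℝ, 0 < x → ∀ n : ℕ, x ^ n = x ^ (n:ℝ) := fun x _ n => (Real.rpow_natCast x n).symm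
  rw [Real.mul_rpow (by positivity) (by positivity), Real.div_rpow (by positivity) (by positivity),
    Real.div_rpow (by positivity) (by positivity), Real.mul_rpow (by positivity) (by positivity),
    Real.mul_rpow (by positivity) (by positivity), e a ha, e b hb, e c hc, e c hc, ← Real.rpow_mul ha.le,
    ← Real.rpow_mul hb.le, ← Real.rpow_mul hc.le]
  rw [div_mul_div_comm, ← Real.rpow_add hc, div_div_eq_mul_div, mul_assoc _ (c ^ _), ← Real.rpow_add hc]
  rw [mul_div_right_comm, mul_div_mul_comm, ← Real.rpow_sub ha, ← Real.rpow_sub hb]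
  norm_num
  ring

lemma change_var : ∫ t in (0:ℝ)..1, ellipticK (√t) ^ 3 / (t * (1 - t)) ^ ((1:ℝ)/6) =
    π ^ 4 / 8 * ∫ y in Set.Ioi (0:ℝ), y ^ 3 * (r2 y * r3 y * r4 y) ^ ((10:ℝ)/3) := by
  rw [intervalIntegral.integral_of_le zero_le_one, integral_Ioc_eq_integral_Ioo, ← tt_image,
    integral_image_eq_integral_abs_deriv_smul measurableSet_Ioi
      (fun y hy => (tt_deriv hy).hasDerivWithinAt) tt_inj, ← MeasureTheory.integral_const_mul]
  refine setIntegral_congr_fun measurableSet_Ioi fun y hy => ?_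
  have hy : 0 < y := hy
  have h3 := r3_pos hy
  have h2 := r2_pos hy
  have h4 := r4_pos hy
  simp only [smul_eq_mul]
  rw [one_sub_tt hy, tt, K_theta hy, abs_of_pos (by positivity), ← pow_lem h4 h2 h3]
  field_simp
  ring


lemma PS_quad {c d : ℤ → ℝ} (e : ℕ → ℝ) (hc : PolyB c) (hd : PolyB d) {s : ℂ} (hs : 0 < s.re)
    (h : ∀ a b : ℤ, ∀ j : ℕ, c (a + 3 * b + j) * d (a - b) = e j) :
    PS c 0 s * PS d 0 (3 * s) = ∑ j : Fin 4, (e j : ℂ) * (PS c1 ((j:ℕ) / 4) (4 * s) * PS c1 ((j:ℕ) / 4) (12 * s)) := by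
  have hs3 : 0 < (3 * s).re := by simpa using hs
  have hs4 : 0 < (4 * s).re := by simpa using hs
  have hs12 : 0 < (12 * s).re := by simpa using hs
  rw [(PS_mul_PS hc hd 0 0 hs hs3).2, tsum_shear 4 _ (PS_mul_PS hc hd 0 0 hs hs3).1]
  refine Finset.sum_congr rfl fun j _ => ?_
  rw [(PS_mul_PS B1 B1 _ _ hs4 hs12).2, ← tsum_mul_left]
  congr 1; ext ⟨a, b⟩
  have := h a b j
  simp only
  rw [show (a + (((4:ℕ):ℤ) - 1) * b + ((j:ℕ):ℤ)) = a + 3 * b + (j:ℕ) by push_cast; ring]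
  rw [mul_mul_mul_comm, mul_mul_mul_comm (c1 a : ℂ), ← Complex.exp_add, ← Complex.exp_add,
      ← Complex.ofReal_mul, this]
  simp only [c1, Complex.ofReal_one, one_mul]
  congr 2; push_cast; ring

lemma PS_34 (s : ℂ) : PS c1 (3/4) s = PS c1 (1/4) s := by
  have h1 := PS_shift c1 (-(1/4)) 1 s
  have h2 := PS_neg c1 (1/4) s
  norm_num at h1
  rw [h1]; norm_num at h2 ⊢
  exact h2

lemma PS_14 {s : ℂ} (hs : 0 < s.re) : 2 * PS c1 (1/4) (4 * s) = T2 s := by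
  have : T2 s = PS c1 (1/4) (4 * s) + PS c1 (3/4) (4 * s) := by
    unfold T2
    conv_lhs => unfold PS
    rw [tsum_divmod 2 _ (B1.summableC (1/2) hs), Fin.sum_univ_two]
    unfold PS
    congr 1
    · congr 1; ext a; simp only [c1]; congr 2; push_cast; simp; ring
    · congr 1; ext a; simp only [c1]; congr 2; push_cast; simp; ring
  rw [this, PS_34]; ring

lemma T_cubic {s : ℂ} (hs : 0 < s.re) : T3 s * T3 (3 * s) - T4 s * T4 (3 * s) = T2 s * T2 (3 * s) := by
  have hs3 : 0 < (3 * s).re := by simpa using hs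
  have h1 := PS_quad (fun _ => 1) B1 B1 hs (by simp [c1])
  have h2 := PS_quad (fun j => ca j) Ba Ba hs (by
    intro a b j
    rw [ca_add, ca_add, ca_sub, show (3 * b : ℤ) = b + b + b by ring, ca_add, ca_add]
    linear_combination (ca b * ca b * ca b * ca b * ca j) * ca_sq a +
      (ca b * ca b * ca j + ca j) * ca_sq b)
  have c0 : ca 0 = 1 := zpow_zero _
  have c2 : ca 2 = 1 := by rw [show (2:ℤ) = 1 + 1 by norm_num, ca_add, ca_one]; norm_num
  have c3 : ca 3 = -1 := by rw [show (3:ℤ) = 1 + 1 + 1 by norm_num, ca_add, ca_add, ca_one]; norm_num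
  unfold T3 T4
  rw [h1, h2, ← PS_14 hs, ← PS_14 hs3]
  simp only [Fin.sum_univ_four]
  have e12 : 4 * (3 * s) = 12 * s := by ring
  simp only [Fin.val_zero, Fin.val_one, Fin.val_two, show ((3 : Fin 4) : ℕ) = 3 from rfl, Nat.cast_zero, Nat.cast_one, Nat.cast_ofNat, c0, c2, c3, ca_one, PS_34, e12]
  push_cast
  ring

lemma r_cubic {y : ℝ} (hy : 0 < y) : r3 y * r3 (3 * y) - r4 y * r4 (3 * y) = r2 y * r2 (3 * y) := by
  have := T_cubic (s := (y:ℂ)) (by simpa using hy)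
  rw [show (3:ℂ) * (y:ℂ) = ((3 * y : ℝ) : ℂ) by push_cast; ring] at this
  simp only [T3r, T2r, T4r] at this
  exact_mod_cast this

lemma r_wronskian2 {y : ℝ} (hy : 0 < y) : r2' y * r3 y - r3' y * r2 y = - (π / 4 * r4 y ^ 4 * r3 y * r2 y) := by
  have h3 := r3_pos hy
  have h2 := r2_pos hy
  have h4 := r4_pos hy
  have w := r_wronskian hy
  have hj := r_jacobi hy
  have k : 4 * r3 y ^ 3 * r3' y = 4 * r2 y ^ 3 * r2' y + 4 * r4 y ^ 3 * r4' y := by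
    have a := (r3_deriv hy).pow 4
    have b := ((r2_deriv hy).pow 4).add ((r4_deriv hy).pow 4)
    have c := b.congr_of_eventuallyEq (f₁ := r3 ^ 4) (by
      filter_upwards [lt_mem_nhds hy] with z hz
      simp; exact r_jacobi hz)
    have := a.unique c
    simp at this; linarith
  have : r2 y ^ 3 * (r2' y * r3 y - r3' y * r2 y) = r2 y ^ 3 * (- (π / 4 * r4 y ^ 4 * r3 y * r2 y)) := by
    linear_combination -(r3 y)/4 * k - r4 y ^ 3 * w + r3' y * hj
  exact mul_left_cancel₀ (by positivity) this

lemma r_deriv_cubic : r4 1 ^ 4 = 3 * r2 3 * r4 3 * (r4 3 ^ 2 + r4 3 * r2 3 + r2 3 ^ 2) := by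
  have h13 : (0:ℝ) < 3 := by norm_num
  have d3 : HasDerivAt (fun y => r3 (3 * y)) (r3' 3 * 3) 1 := by
    have hlin : HasDerivAt (fun y : ℝ => 3 * y) 3 1 := by simpa using (hasDerivAt_id (1:ℝ)).const_mul 3
    exact HasDerivAt.comp (h₂ := r3) 1 (by rw [mul_one]; exact r3_deriv h13) hlin
  have d4 : HasDerivAt (fun y => r4 (3 * y)) (r4' 3 * 3) 1 := by
    have hlin : HasDerivAt (fun y : ℝ => 3 * y) 3 1 := by simpa using (hasDerivAt_id (1:ℝ)).const_mul 3
    exact HasDerivAt.comp (h₂ := r4) 1 (by rw [mul_one]; exact r4_deriv h13) hlin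
  have d2 : HasDerivAt (fun y => r2 (3 * y)) (r2' 3 * 3) 1 := by
    have hlin : HasDerivAt (fun y : ℝ => 3 * y) 3 1 := by simpa using (hasDerivAt_id (1:ℝ)).const_mul 3
    exact HasDerivAt.comp (h₂ := r2) 1 (by rw [mul_one]; exact r2_deriv h13) hlin
  have k : (r3' 1 * r3 3 + r3 1 * (r3' 3 * 3)) - (r4' 1 * r4 3 + r4 1 * (r4' 3 * 3)) =
      r2' 1 * r2 3 + r2 1 * (r2' 3 * 3) := by
    have a := ((r3_deriv one_pos).mul d3).sub ((r4_deriv one_pos).mul d4)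
    have b := (r2_deriv one_pos).mul d2
    have c := b.congr_of_eventuallyEq (f₁ := (r3 * fun y => r3 (3 * y)) - (r4 * fun y => r4 (3 * y))) (by
      filter_upwards [lt_mem_nhds one_pos] with z hz
      simp; exact r_cubic hz)
    have := a.unique c
    simpa using this
  have w1 := r_wronskian one_pos
  have w3 := r_wronskian h13
  have v1 := r_wronskian2 one_pos
  have v3 := r_wronskian2 h13
  have hc := r_cubic one_pos
  rw [mul_one] at hc
  rw [r_one] at k w1 v1 hc
  have A := r3_pos one_pos
  have B := r4_pos one_pos
  have P := r2_pos h13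
  have Q := r3_pos h13
  have S := r4_pos h13
  have hlt : r2 3 ≠ r4 3 := by
    intro h
    have h1 : tt 3 = 1/2 := by
      have := one_sub_tt h13
      rw [h, ← tt] at this; linarith
    have h2 : tt 1 = 1/2 := by
      have := tt_inv one_pos
      rw [inv_one] at this; linarith
    have := tt_inj (show (3:ℝ) ∈ Set.Ioi 0 from h13) (Set.mem_Ioi.mpr (one_pos : (0:ℝ) < 1)) (h1.trans h2.symm)
    norm_num at this
  have key : (π / 4 * r4 1 * r3 1 * r3 3) * ((r2 3 - r4 3) * (r4 1 ^ 4 - 3 * r2 3 * r4 3 * (r4 3 ^ 2 + r4 3 * r2 3 + r2 3 ^ 2))) = 0 := by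
    linear_combination (r3 1 * r3 3) * k + r4 3 * r3 3 * w1 + 3 * r4 1 * r3 1 * w3 + r2 3 * r3 3 * v1 + 3 * r4 1 * r3 1 * v3 - (r3' 1 * r3 3 + 3 * r3 1 * r3' 3) * hc
  have := (mul_eq_zero.mp key).resolve_left (by positivity)
  have := (mul_eq_zero.mp this).resolve_left (sub_ne_zero.mpr hlt)
  linarith

lemma tt_mono : StrictMonoOn tt (Set.Ioi 0) := by
  apply strictMonoOn_of_deriv_pos (convex_Ioi 0)
  · exact fun y hy => (tt_deriv hy).continuousAt.continuousWithinAt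
  · intro y hy
    rw [interior_Ioi] at hy
    have hy : 0 < y := hy
    rw [(tt_deriv hy).deriv]
    have h3 := r3_pos hy
    have h2 := r2_pos hy
    have h4 := r4_pos hy
    positivity

lemma F_alg {A B P Q S x z : ℝ} (hA : 0 < A) (hB : 0 < B) (hP : 0 < P) (hQ : 0 < Q) (hS : 0 < S)
    (hx : 0 < x) (hz : 0 < z) (hx4 : x ^ 4 = 3) (hz2 : z ^ 2 = 2) (hPS : P < S) (hAB : A ^ 4 = 2 * B ^ 4)
    (hj : Q ^ 4 = P ^ 4 + S ^ 4) (h1 : A * Q = B * (P + S))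
    (h2 : B ^ 4 = 3 * P * S * (S ^ 2 + S * P + P ^ 2)) :
    P ^ 2 * S ^ 2 * (S ^ 4 - P ^ 4) = A ^ 8 * (z * x * (2 - x ^ 2) / 27) := by
  have hx2 : x ^ 2 < 2 := by nlinarith
  have hAB2 : A ^ 2 = z * B ^ 2 := by
    have : (A ^ 2) ^ 2 = (z * B ^ 2) ^ 2 := by rw [mul_pow, hz2]; linarith
    exact (pow_left_inj₀ (by positivity) (by positivity) two_ne_zero).mp this
  have h3 : z * Q ^ 2 = (P + S) ^ 2 := by
    have : B ^ 2 * (z * Q ^ 2) = B ^ 2 * (P + S) ^ 2 := by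
      rw [← mul_pow, ← h1]; linear_combination -(Q^2) * hAB2
    exact mul_left_cancel₀ (by positivity) this
  -- e = P S ; 2 e^2 - 4 z e Q^2 + Q^4 = 0
  have h4 : (z * (P * S) - 2 * Q ^ 2) ^ 2 = (x ^ 2 * Q ^ 2) ^ 2 := by
    have q : P ^ 2 + S ^ 2 = z * Q ^ 2 - 2 * (P * S) := by linarith
    have q2 : P ^ 4 + S ^ 4 = (z * Q ^ 2 - 2 * (P * S)) ^ 2 - 2 * (P * S) ^ 2 := by rw [← q]; ring
    rw [← hj] at q2
    linear_combination -q2 - Q ^ 4 * hx4 + ((P * S) ^ 2 - Q ^ 4) * hz2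
  have h5 : z * (P * S) = (2 - x ^ 2) * Q ^ 2 := by
    have hle : 4 * (P * S) ≤ z * Q ^ 2 := by nlinarith [sq_nonneg (P - S)]
    have : z * (P * S) ≤ Q ^ 2 / 2 := by nlinarith
    rcases sq_eq_sq_iff_eq_or_eq_neg.mp h4 with h | h
    · nlinarith [sq_nonneg x, sq_nonneg Q, mul_nonneg (sq_nonneg x) (sq_nonneg Q), pow_pos hQ 2]
    · linarith
  have hA4 : A ^ 4 = 3 * x ^ 2 * (2 - x ^ 2) * Q ^ 4 := by
    have q : S ^ 2 + S * P + P ^ 2 = z * Q ^ 2 - P * S := by linarith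
    rw [hAB, h2, q]
    have h6 : 2 * (P * S) = z * ((2 - x ^ 2) * Q ^ 2) := by rw [← h5]; linear_combination -(P * S) * hz2
    have h7 : 2 * (z * Q ^ 2 - P * S) = z * (x ^ 2 * Q ^ 2) := by linear_combination -h6
    have : 2 * (2 * (3 * P * S * (z * Q ^ 2 - P * S))) = 3 * (2 * (P * S)) * (2 * (z * Q ^ 2 - P * S)) := by ring
    rw [h6, h7] at this
    linear_combination this / 2 + 3/2 * x^2 * (2 - x^2) * Q^4 * hz2
  have h8 : S ^ 4 - P ^ 4 = 2 * z * x * (2 - x ^ 2) * Q ^ 4 := by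
    have pos : 0 < S ^ 4 - P ^ 4 := by
      have := pow_lt_pow_left₀ hPS hP.le (n := 4) (by norm_num)
      linarith
    have pos2 : 0 < 2 - x ^ 2 := by linarith
    have : (S ^ 4 - P ^ 4) ^ 2 = (2 * z * x * (2 - x ^ 2) * Q ^ 4) ^ 2 := by
      have e4 : 4 * (P * S) ^ 4 = ((2 - x ^ 2) * Q ^ 2) ^ 4 := by
        rw [← h5]; linear_combination -(P*S)^4 * (z^2 + 2) * hz2
      have : (S ^ 4 - P ^ 4) ^ 2 = (Q ^ 4) ^ 2 - 4 * (P * S) ^ 4 := by rw [hj]; ring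
      rw [this, e4]
      linear_combination -(4 * x ^ 2 * (2 - x^2)^2 * Q^8) * hz2 - Q^8*(x^4 - 5) * hx4
    exact (pow_left_inj₀ pos.le (by positivity) two_ne_zero).mp this
  have : P ^ 2 * S ^ 2 = (2 - x ^ 2) ^ 2 * Q ^ 4 / 2 := by
    have : (z * (P * S)) ^ 2 = ((2 - x ^ 2) * Q ^ 2) ^ 2 := by rw [h5]
    linear_combination this / 2 - (P * S) ^ 2 / 2 * hz2
  rw [h8, this, show A ^ 8 = (A ^ 4) ^ 2 by ring, hA4]
  linear_combination -(1/3) * z * x * (2 - x ^2)^3 * Q^8 * hx4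

lemma F_val : r2 3 ^ 2 * r4 3 ^ 2 * (r4 3 ^ 4 - r2 3 ^ 4) =
    r3 1 ^ 8 * (√2 * 3 ^ ((1:ℝ)/4) * (2 - √3) / 27) := by
  have h13 : (0:ℝ) < 3 := by norm_num
  have hx2 : ((3:ℝ) ^ ((1:ℝ)/4)) ^ 2 = √3 := by
    rw [← Real.rpow_natCast, ← Real.rpow_mul h13.le, Real.sqrt_eq_rpow]; norm_num
  have hx4 : ((3:ℝ) ^ ((1:ℝ)/4)) ^ 4 = 3 := by
    rw [← Real.rpow_natCast, ← Real.rpow_mul h13.le]; norm_num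
  have hc := r_cubic one_pos
  rw [mul_one, r_one] at hc
  have hPS : r2 3 < r4 3 := by
    have h2 : tt 1 = 1/2 := by
      have := tt_inv one_pos
      rw [inv_one] at this; linarith
    have h3 := tt_mono (Set.mem_Ioi.mpr (one_pos : (0:ℝ) < 1)) (show (3:ℝ) ∈ Set.Ioi 0 from h13) (by norm_num)
    have h4 := one_sub_tt h13
    have h5 : r2 3 ^ 4 / r3 3 ^ 4 < r4 3 ^ 4 / r3 3 ^ 4 := by rw [← h4, ← tt]; linarith
    have h6 := (div_lt_div_iff_of_pos_right (pow_pos (r3_pos h13) 4)).mp h5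
    exact lt_of_pow_lt_pow_left₀ 4 (r4_pos h13).le h6
  rw [← hx2]
  exact F_alg (r3_pos one_pos) (r4_pos one_pos) (r2_pos h13) (r3_pos h13) (r4_pos h13) (by positivity)
    (by positivity) hx4 (by norm_num) hPS r3_one (r_jacobi h13) (by linarith) r_deriv_cubic


open UpperHalfPlane hiding I in
lemma denom_T' (z : UpperHalfPlane) : denom (ModularGroup.T : Matrix.GeneralLinearGroup (Fin 2) ℝ) z = 1 := by
  rw [ModularGroup.denom_apply]
  simp [ModularGroup.T]

open UpperHalfPlane hiding I in
lemma slash_of {f : UpperHalfPlane → ℂ} {k : ℕ}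
    (hS : ∀ z : UpperHalfPlane, f (ModularGroup.S • z) = (z:ℂ) ^ k * f z)
    (hT : ∀ z : UpperHalfPlane, f (ModularGroup.T • z) = f z) (γ : Matrix.SpecialLinearGroup (Fin 2) ℤ) :
    SlashAction.map (k:ℤ) γ f = f := by
  apply SlashInvariantForm.slash_action_generators_SL2Z
  · ext z
    rw [ModularForm.SL_slash_apply, hS, ModularGroup.denom_S]
    have := z.ne_zero
    simp only [zpow_neg, zpow_natCast]
    field_simp
  · ext z
    rw [ModularForm.SL_slash_apply, hT]
    simp [denom_T']

open UpperHalfPlane hiding I in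
open scoped Manifold in
noncomputable def mkMF (f : UpperHalfPlane → ℂ) (k : ℕ) (hd : MDiff f)
    (hS : ∀ z : UpperHalfPlane, f (ModularGroup.S • z) = (z:ℂ) ^ k * f z)
    (hT : ∀ z : UpperHalfPlane, f (ModularGroup.T • z) = f z) (hb : IsBoundedAtImInfty f) :
    ModularForm (Matrix.SpecialLinearGroup.mapGL (n := Fin 2) (R := ℤ) ℝ).range k where
  toFun := f
  slash_action_eq' A hA := by
    obtain ⟨A, rfl⟩ := hA
    exact slash_of hS hT A
  holo' := hd
  bdd_at_cusps' hc := by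
    rw [Subgroup.IsArithmetic.isCusp_iff_isCusp_SL2Z] at hc
    rw [OnePoint.isBoundedAt_iff_forall_SL2Z hc]
    intro γ _
    rw [slash_of hS hT]
    exact hb

open UpperHalfPlane hiding I in
open scoped Manifold in
noncomputable def mkCF (f : UpperHalfPlane → ℂ) (k : ℕ) (hd : MDiff f)
    (hS : ∀ z : UpperHalfPlane, f (ModularGroup.S • z) = (z:ℂ) ^ k * f z)
    (hT : ∀ z : UpperHalfPlane, f (ModularGroup.T • z) = f z) (hb : IsZeroAtImInfty f) :
    CuspForm (Matrix.SpecialLinearGroup.mapGL (n := Fin 2) (R := ℤ) ℝ).range k where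
  toFun := f
  slash_action_eq' A hA := by
    obtain ⟨A, rfl⟩ := hA
    exact slash_of hS hT A
  holo' := hd
  zero_at_cusps' hc := by
    rw [Subgroup.IsArithmetic.isCusp_iff_isCusp_SL2Z] at hc
    rw [OnePoint.isZeroAt_iff_forall_SL2Z hc]
    intro γ _
    rw [slash_of hS hT]
    exact hb

open UpperHalfPlane hiding I in
open scoped Manifold in
lemma tendsto_s : Filter.Tendsto (fun z : UpperHalfPlane => -I * (z:ℂ)) atImInfty (Filter.comap Complex.re Filter.atTop) := by
  rw [Filter.tendsto_comap_iff]
  have : (Complex.re ∘ fun z : UpperHalfPlane => -I * (z:ℂ)) = UpperHalfPlane.im := by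
    ext z; simp
  rw [this]
  exact Filter.tendsto_comap

open UpperHalfPlane hiding I in
open scoped Manifold in
lemma s_re (z : UpperHalfPlane) : 0 < (-I * (z:ℂ)).re := by simpa using z.im_pos

open UpperHalfPlane hiding I in
open scoped Manifold in
lemma mdiff_s {G : ℂ → ℂ} (hd : ∀ s : ℂ, 0 < s.re → DifferentiableAt ℂ G s) :
    MDiff (fun z : UpperHalfPlane => G (-I * (z:ℂ))) := by
  rw [UpperHalfPlane.mdifferentiable_iff]
  have : DifferentiableOn ℂ (fun z => G (-I * z)) {z | 0 < z.im} := by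
    intro z hz
    have h1 : 0 < (-I * z).re := by simpa using hz
    exact ((hd _ h1).comp z (by fun_prop)).differentiableWithinAt
  refine this.congr fun z hz => ?_
  simp [ofComplex_apply_of_im_pos hz]

open UpperHalfPlane hiding I in
open scoped Manifold in
lemma s_S {G : ℂ → ℂ} {k : ℕ} (hk : 4 ∣ k) (hS : ∀ s : ℂ, 0 < s.re → G s⁻¹ = s ^ k * G s) (z : UpperHalfPlane) :
    G (-I * ((ModularGroup.S • z : UpperHalfPlane):ℂ)) = (z:ℂ) ^ k * G (-I * (z:ℂ)) := by
  have h := hS _ (s_re z)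
  have e : (-I * (z:ℂ))⁻¹ = -I * ((ModularGroup.S • z : UpperHalfPlane):ℂ) := by
    rw [modular_S_smul]
    have := z.ne_zero
    simp
    try field_simp
    try simp
  rw [← e, h, mul_pow]
  obtain ⟨m, rfl⟩ := hk
  have : (-I) ^ (4 * m) = 1 := by
    rw [pow_mul, neg_pow, I_pow_four]; norm_num
  rw [this, one_mul]

open UpperHalfPlane hiding I in
open scoped Manifold in
lemma s_T {G : ℂ → ℂ} (hT : ∀ s : ℂ, 0 < s.re → G (s - I) = G s) (z : UpperHalfPlane) :
    G (-I * ((ModularGroup.T • z : UpperHalfPlane):ℂ)) = G (-I * (z:ℂ)) := by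
  rw [← hT _ (s_re z)]
  congr 1
  rw [modular_T_smul]
  simp
  ring

lemma L_wt0 {G : ℂ → ℂ} {c : ℂ} (hd : ∀ s : ℂ, 0 < s.re → DifferentiableAt ℂ G s)
    (hS : ∀ s : ℂ, 0 < s.re → G s⁻¹ = G s) (hT : ∀ s : ℂ, 0 < s.re → G (s - I) = G s)
    (hl : Filter.Tendsto G (Filter.comap Complex.re Filter.atTop) (nhds c)) {s : ℂ} (hs : 0 < s.re) :
    G s = c := by
  have hl' := hl.comp tendsto_s
  let F := mkMF (fun z => G (-I * (z:ℂ))) 0 (mdiff_s hd) (s_S (by norm_num) (by simpa using hS)) (s_T hT)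
    (hl'.isBigO_one ℝ)
  obtain ⟨d, hd'⟩ := ModularFormClass.levelOne_weight_zero_const F
  have h1 : ∀ z : UpperHalfPlane, G (-I * (z:ℂ)) = d := fun z => congrFun hd' z
  have h2 : d = c := by
    refine tendsto_nhds_unique (tendsto_const_nhds (f := UpperHalfPlane.atImInfty)) (hl'.congr h1)
  have h3 := h1 ⟨I * s, by simpa using hs⟩
  have e : -I * (I * s) = s := by rw [← mul_assoc]; simp
  change G (-I * (I * s)) = d at h3
  rw [e] at h3
  rw [h3, h2]

lemma L_wt4 {G : ℂ → ℂ} (hd : ∀ s : ℂ, 0 < s.re → DifferentiableAt ℂ G s)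
    (hS : ∀ s : ℂ, 0 < s.re → G s⁻¹ = s ^ 4 * G s) (hT : ∀ s : ℂ, 0 < s.re → G (s - I) = G s)
    (hl : Filter.Tendsto G (Filter.comap Complex.re Filter.atTop) (nhds 0)) {s : ℂ} (hs : 0 < s.re) :
    G s = 0 := by
  have hl' := hl.comp tendsto_s
  let F := mkCF (fun z => G (-I * (z:ℂ))) 4 (mdiff_s hd) (s_S (by norm_num) (by simpa using hS)) (s_T hT)
    hl'
  have hr := CuspForm.rank_eq_zero_of_weight_lt_twelve (k := ((4:ℕ):ℤ)) (by norm_num)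
  rw [rank_zero_iff] at hr
  have h0 : F = 0 := Subsingleton.elim _ _
  have h3 : F ⟨I * s, by simpa using hs⟩ = 0 := by rw [h0]; rfl
  have e : -I * (I * s) = s := by rw [← mul_assoc]; simp
  change G (-I * (I * s)) = 0 at h3
  rwa [e] at h3

noncomputable def Dl (s : ℂ) : ℂ := ModularForm.eta (I * s) ^ 24

lemma Is_im {s : ℂ} (hs : 0 < s.re) : 0 < (I * s).im := by simpa using hs

lemma Dl_ne {s : ℂ} (hs : 0 < s.re) : Dl s ≠ 0 :=
  pow_ne_zero _ (ModularForm.eta_ne_zero (Is_im hs))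

lemma Dl_diff {s : ℂ} (hs : 0 < s.re) : DifferentiableAt ℂ Dl s := by
  have := ModularForm.differentiableAt_eta_of_mem_upperHalfPlaneSet (Is_im hs)
  exact (this.comp s (f := fun s => I * s) (by fun_prop)).pow 24

lemma Dl_eq {s : ℂ} (hs : 0 < s.re) : Dl s = ModularForm.discriminant ⟨I * s, Is_im hs⟩ := rfl

open UpperHalfPlane hiding I in
open scoped Manifold in
lemma Dl_S {s : ℂ} (hs : 0 < s.re) : Dl s⁻¹ = s ^ 12 * Dl s := by
  have h := congrFun ModularForm.discriminant_S_invariant ⟨I * s, Is_im hs⟩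
  rw [ModularForm.SL_slash_apply, ModularGroup.denom_S, ← Dl_eq hs] at h
  have h2 : ModularForm.discriminant (ModularGroup.S • (⟨I * s, Is_im hs⟩ : UpperHalfPlane)) = Dl s⁻¹ := by
    rw [Dl, ModularForm.discriminant, modular_S_smul]
    congr 2
    simp
    try rw [mul_comm]
  rw [h2] at h
  change Dl s⁻¹ * (I * s) ^ (-12:ℤ) = _ at h
  rw [← h]
  have : s ≠ 0 := ne0 hs
  have hI : (I:ℂ) ^ 12 = 1 := by rw [show 12 = 4 * 3 by norm_num, pow_mul, I_pow_four, one_pow]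
  rw [zpow_neg, show (12:ℤ) = ((12:ℕ):ℤ) by rfl, zpow_natCast, mul_pow, hI]
  field_simp

open UpperHalfPlane hiding I in
open scoped Manifold in
lemma Dl_T {s : ℂ} (hs : 0 < s.re) : Dl (s - I) = Dl s := by
  have h := congrFun ModularForm.discriminant_T_invariant ⟨I * s, Is_im hs⟩
  rw [ModularForm.SL_slash_apply, ← Dl_eq hs] at h
  have h2 : ModularForm.discriminant (ModularGroup.T • (⟨I * s, Is_im hs⟩ : UpperHalfPlane)) = Dl (s - I) := by
    rw [Dl, ModularForm.discriminant, modular_T_smul]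
    congr 2
    simp [mul_sub]
    try ring
  rw [h2] at h
  rw [← h]
  rw [denom_T']; simp

open UpperHalfPlane hiding I in
open scoped Manifold in
lemma Dl_lim : Filter.Tendsto (fun s : ℂ => cexp (2 * π * s) * Dl s) (Filter.comap Complex.re Filter.atTop) (nhds 1) := by
  have h := ModularForm.tendsto_atImInfty_tprod_one_sub_eta_q_pow
  have h2 : Filter.Tendsto (fun s : ℂ => ofComplex (I * s)) (Filter.comap Complex.re Filter.atTop) atImInfty := by
    rw [atImInfty, Filter.tendsto_comap_iff]
    refine Filter.Tendsto.congr' ?_ Filter.tendsto_comap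
    filter_upwards [Filter.preimage_mem_comap (Filter.Ioi_mem_atTop (0:ℝ))] with s hs
    simp [ofComplex_apply_of_im_pos (Is_im hs)]
    try rfl
  refine (h.comp h2).congr' ?_
  filter_upwards [Filter.preimage_mem_comap (Filter.Ioi_mem_atTop (0:ℝ))] with s hs
  rw [Dl_eq hs, ModularForm.discriminant_eq_q_prod]
  simp only [Function.comp, ofComplex_apply_of_im_pos (Is_im hs), Function.Periodic.qParam, ← mul_assoc, ← Complex.exp_add]
  change _ = cexp (2 * π * s + 2 * π * I * I * s / (1:ℝ)) * _
  rw [show 2 * π * s + 2 * π * I * I * s / (1:ℝ) = 0 by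
    push_cast; linear_combination (2 * π * s) * I_sq]
  simp

lemma L_disc (m : ℕ) {G : ℂ → ℂ} {c : ℂ} (hd : ∀ s : ℂ, 0 < s.re → DifferentiableAt ℂ G s)
    (hS : ∀ s : ℂ, 0 < s.re → G s⁻¹ = s ^ (12 * m) * G s) (hT : ∀ s : ℂ, 0 < s.re → G (s - I) = G s)
    (hl : Filter.Tendsto (fun s => cexp (2 * π * s) ^ m * G s) (Filter.comap Complex.re Filter.atTop) (nhds c)) {s : ℂ} (hs : 0 < s.re) :
    G s = c * Dl s ^ m := by
  have := L_wt0 (G := fun s => G s / Dl s ^ m) (c := c)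
    (fun s hs => (hd s hs).div ((Dl_diff hs).pow m) (pow_ne_zero _ (Dl_ne hs)))
    (fun s hs => by
      have h0 := Dl_ne hs
      have := ne0 hs

      rw [hS s hs, Dl_S hs, mul_pow, pow_mul]
      field_simp)
    (fun s hs => by rw [hT s hs, Dl_T hs])
    (by
      have := hl.div (Dl_lim.pow m) (by simp)
      simp only [one_pow, div_one] at this
      refine this.congr fun s => ?_
      simp only [Pi.div_apply]
      rw [mul_pow, mul_div_mul_left _ _ (pow_ne_zero _ (Complex.exp_ne_zero _))]) hs

  rw [← this]
  field_simp [Dl_ne hs]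


lemma ph_half (n : ℤ) : cexp (π * ((n:ℂ) + 1/2) ^ 2 * I) = cexp (π * I / 4) := by
  obtain ⟨k, hk⟩ := Int.even_mul_succ_self n
  have hk' : (n:ℂ) * (n + 1) = k + k := by exact_mod_cast hk
  rw [show π * ((n:ℂ) + 1/2) ^ 2 * I = π * I / 4 + k * (2 * π * I) by linear_combination (π * I) * hk']
  exact Complex.exp_periodic.int_mul k _

lemma PS_T_half (c : ℤ → ℝ) (s : ℂ) : PS c (1/2) (s - I) = cexp (π * I / 4) * PS c (1/2) s := by
  unfold PS
  rw [← tsum_mul_left]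
  congr 1; ext n
  rw [← ph_half n, mul_left_comm, ← Complex.exp_add]
  congr 2
  push_cast; ring

lemma PS_T_zero (c : ℤ → ℝ) (s : ℂ) : PS c 0 (s - I) = PS (fun n => c n * ca n) 0 s := by
  unfold PS
  congr 1; ext n
  have : (ca n : ℂ) = cexp (π * (n:ℂ)^2 * I) := by
    obtain ⟨k, hk⟩ := Int.even_mul_succ_self (n-1)
    have hk' : (n:ℂ) ^ 2 = n + (k + k) := by
      have : (n-1)*(n-1+1) = k + k := hk
      have : n ^ 2 = n + (k + k) := by linear_combination this
      exact_mod_cast this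
    rw [← cexp_pi_n, hk', show π * ((n:ℂ) + (k + k)) * I = π * I * n + k * (2 * π * I) by ring]
    exact (Complex.exp_periodic.int_mul k _).symm
  push_cast
  rw [this, mul_assoc, ← Complex.exp_add]
  congr 2
  ring

lemma T3_T (s : ℂ) : T3 (s - I) = T4 s := by
  rw [T3, T4, PS_T_zero]; simp [c1]
lemma T4_T (s : ℂ) : T4 (s - I) = T3 s := by
  rw [T3, T4, PS_T_zero]
  congr 1; ext n; rw [ca_sq]; rfl
lemma T2_T (s : ℂ) : T2 (s - I) = cexp (π * I / 4) * T2 s := PS_T_half _ _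

lemma PS_T_third {c d : ℤ → ℝ} (k : ℝ) (hc : PolyB c) (h : ∀ m, c (3 * m + 1) = k * d m) {s : ℂ} (hs : 0 < s.re) :
    PS c (1/2) ((s - I) / 3) = cexp (π * I / 12) * PS c (1/2) (s / 3) +
      (cexp (π * I / 12) ^ 9 - cexp (π * I / 12)) * k * PS d (1/2) (3 * s) := by
  have hs3 : 0 < (s/3).re := by
    have : (s/3).re = s.re/3 := by simp
    rw [this]; positivity
  have hs3' : 0 < ((s-I)/3).re := by
    have : ((s-I)/3).re = s.re/3 := by simp
    rw [this]; positivity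
  unfold PS
  rw [tsum_divmod 3 _ (hc.summableC (1/2) hs3'), tsum_divmod 3 _ (hc.summableC (1/2) hs3)]
  rw [Fin.sum_univ_three, Fin.sum_univ_three]
  have h0 : ∀ (j : ℕ), (j = 0 ∨ j = 2) → (∑' a : ℤ, (c ((3:ℕ) * a + j) : ℂ) * cexp (-(π * (((3:ℕ) * a + j : ℤ) + 1/2) ^ 2 : ℝ) * ((s - I) / 3)))
      = cexp (π * I / 12) * (∑' a : ℤ, (c ((3:ℕ) * a + j) : ℂ) * cexp (-(π * (((3:ℕ) * a + j : ℤ) + 1/2) ^ 2 : ℝ) * (s / 3))) := by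
    intro j hj
    rw [← tsum_mul_left]
    congr 1; ext a
    have : ∃ k : ℤ, (π * ((3 * (a:ℂ) + j) + 1/2) ^ 2 * I / 3) = π * I / 12 + k * (2 * π * I) := by
      obtain ⟨k, hk⟩ := Int.even_mul_succ_self a
      have hk' : (a:ℂ) ^ 2 = k + k - a := by
        have : a ^ 2 = k + k - a := by linear_combination hk
        exact_mod_cast this
      rcases hj with rfl | rfl
      · have : ∃ k : ℤ, a * (3 * a + 1) = 2 * k := by
          obtain ⟨k, hk⟩ := Int.even_mul_succ_self a
          exact ⟨k + a * a, by linear_combination hk⟩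
        obtain ⟨k, hk⟩ := this
        refine ⟨k, ?_⟩
        have hk' : (a:ℂ) * (3 * a + 1) = 2 * k := by exact_mod_cast hk
        push_cast
        linear_combination (π * I) * hk'
      · have : ∃ k : ℤ, (a + 1) * (3 * a + 2) = 2 * k := by
          obtain ⟨k, hk⟩ := Int.even_mul_succ_self a
          exact ⟨k + (a+1) * (a + 1), by linear_combination hk⟩
        obtain ⟨k, hk⟩ := this
        refine ⟨k, ?_⟩
        have hk' : ((a:ℂ) + 1) * (3 * a + 2) = 2 * k := by exact_mod_cast hk
        push_cast
        linear_combination (π * I) * hk'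
    obtain ⟨k, hk⟩ := this
    have e : cexp (π * I / 12) = cexp (π * ((3 * (a:ℂ) + j) + 1/2) ^ 2 * I / 3) := by
      rw [hk]; exact (Complex.exp_periodic.int_mul k _).symm
    rw [e, mul_left_comm, ← Complex.exp_add]
    congr 2
    push_cast; ring
  have hB : (∑' a : ℤ, (c ((3:ℕ) * a + (1:ℕ)) : ℂ) * cexp (-(π * (((3:ℕ) * a + (1:ℕ) : ℤ) + 1/2) ^ 2 : ℝ) * (s / 3))) =
      k * ∑' n : ℤ, (d n : ℂ) * cexp (-(π * (n + 1/2) ^ 2 : ℝ) * (3 * s)) := by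
    rw [← tsum_mul_left]
    congr 1; ext a
    have := h a
    push_cast at this ⊢
    rw [this]
    push_cast
    rw [mul_assoc]
    congr 3
    ring
  have hC : (∑' a : ℤ, (c ((3:ℕ) * a + (1:ℕ)) : ℂ) * cexp (-(π * (((3:ℕ) * a + (1:ℕ) : ℤ) + 1/2) ^ 2 : ℝ) * ((s - I) / 3))) =
      cexp (π * I / 12) ^ 9 * (∑' a : ℤ, (c ((3:ℕ) * a + (1:ℕ)) : ℂ) * cexp (-(π * (((3:ℕ) * a + (1:ℕ) : ℤ) + 1/2) ^ 2 : ℝ) * (s / 3))) := by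
    rw [← tsum_mul_left]
    congr 1; ext a
    have e : cexp (π * I / 12) ^ 9 = cexp (π * ((a:ℂ) + 1/2) ^ 2 * I) ^ 3 := by
      rw [ph_half, ← Complex.exp_nat_mul, ← Complex.exp_nat_mul]
      congr 1; push_cast; ring
    rw [e, ← Complex.exp_nat_mul, mul_left_comm, ← Complex.exp_add]
    congr 2
    push_cast; ring
  have z0 := h0 0 (Or.inl rfl)
  have z2 := h0 2 (Or.inr rfl)
  simp only [Fin.val_zero, Fin.val_one, Fin.val_two] at *
  rw [z0, z2, hC]
  rw [hB]
  ring

lemma cf_three (m : ℤ) : cf (3 * m + 1) = (-3:ℝ) * cf m := by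
  have h := ca_add (3 * m) 1
  have h2 : ca (3 * m) = ca m := by
    rw [show 3 * m = m + (m + m) by ring, ca_add, ca_add, ca_sq, mul_one]
  rw [ca_one, h2] at h
  simp only [cf]
  change ca (3 * m + 1) * _ = _ * (ca m * _)
  rw [h]; push_cast; ring

lemma cg_three (m : ℤ) : cg (3 * m + 1) = (-27:ℝ) * cg m := by
  have h := ca_add (3 * m) 1
  have h2 : ca (3 * m) = ca m := by
    rw [show 3 * m = m + (m + m) by ring, ca_add, ca_add, ca_sq, mul_one]
  rw [ca_one, h2] at h
  simp only [cg]
  change ca (3 * m + 1) * _ = _ * (ca m * _)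
  rw [h]; push_cast; ring

noncomputable def WW (s : ℂ) : ℂ := 9 * F1 (s / 3) * F3 (3 * s) - F3 (s / 3) * F1 (3 * s)

lemma WW_T {s : ℂ} (hs : 0 < s.re) : WW (s - I) = cexp (π * I / 12) ^ 10 * WW s := by
  have hT3 : ∀ c, PS c (1/2) (3 * (s - I)) = cexp (π * I / 12) ^ 9 * PS c (1/2) (3 * s) := by
    intro c
    rw [show 3 * (s - I) = ((3 * s - I) - I) - I by ring, PS_T_half, PS_T_half, PS_T_half,
      show cexp (π * I / 4) = cexp (π * I / 12) ^ 3 by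
        rw [← Complex.exp_nat_mul]; congr 1; push_cast; ring]
    ring
  unfold WW F1 F3
  rw [hT3, hT3, PS_T_third _ Bf cf_three hs, PS_T_third _ Bg cg_three hs]
  push_cast; ring

lemma F1_deriv {s : ℂ} (hs : 0 < s.re) : HasDerivAt F1 (-(π/4) * F3 s) s := by
  have h := Bf.hasDerivAt (1/2) hs
  suffices e : -(π/4) * F3 s = PS (fun n => cf n * -(π * (n + 1/2) ^ 2)) (1/2) s by
    rw [e]; exact h
  unfold F3 PS
  rw [← tsum_mul_left]
  congr 1; ext n
  simp only [cf, cg]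
  push_cast; ring

lemma F3_diff {s : ℂ} (hs : 0 < s.re) : DifferentiableAt ℂ F3 s :=
  (Bg.hasDerivAt (1/2) hs).differentiableAt

lemma half_sq {s : ℂ} : (s ^ (1/2:ℂ)) ^ 2 = s := by
  simp

lemma F3_S {s : ℂ} (hs : 0 < s.re) : F3 s⁻¹ = s ^ (1/2:ℂ) * (6 / π * s ^ 2 * F1 s - s ^ 3 * F3 s) := by
  have h0 := ne0 hs
  have d1 : HasDerivAt (fun s => F1 s⁻¹) (-(π/4) * F3 s⁻¹ * (-(s^2)⁻¹)) s :=
    (F1_deriv (inv_re_pos hs)).comp s (hasDerivAt_inv h0)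
  have hsl : s ∈ slitPlane := Or.inl hs
  have d2 : HasDerivAt (fun s : ℂ => s ^ (1/2:ℂ)) ((1/2) * s ^ ((1/2:ℂ) - 1) * 1) s :=
    (hasDerivAt_id s).cpow_const hsl
  have d3 : HasDerivAt (fun s : ℂ => s * s ^ (1/2:ℂ) * F1 s) _ s :=
    ((hasDerivAt_id s).mul d2).mul (F1_deriv hs)
  have d4 := d3.congr_of_eventuallyEq (f₁ := fun s => F1 s⁻¹) (by
    filter_upwards [(isOpen_lt continuous_const Complex.continuous_re).mem_nhds hs] with z hz
    exact F1_S hz)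
  have e := d1.unique d4
  rw [Complex.cpow_sub _ _ h0, Complex.cpow_one] at e
  simp only [id] at e
  have hp : (π:ℂ) ≠ 0 := by exact_mod_cast pi_ne_zero
  simp only [Pi.mul_apply, id] at e
  field_simp at e ⊢
  linear_combination e / 2

lemma WW_S {s : ℂ} (hs : 0 < s.re) :
    WW s⁻¹ = (3 * s) ^ (1/2:ℂ) * (s / 3) ^ (1/2:ℂ) * s ^ 4 * WW s := by
  have hs3 : 0 < (s/3).re := by
    have : (s/3).re = s.re/3 := by simp
    rw [this]; positivity
  have hs3' : 0 < (3 * s).re := by simpa using hs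
  have h0 := ne0 hs
  have hp : (π:ℂ) ≠ 0 := by exact_mod_cast pi_ne_zero
  unfold WW
  rw [show s⁻¹ / 3 = (3 * s)⁻¹ by field_simp, show 3 * s⁻¹ = (s / 3)⁻¹ by field_simp,
    F1_S hs3, F1_S hs3', F3_S hs3, F3_S hs3']
  field_simp
  ring

lemma WW_diff {s : ℂ} (hs : 0 < s.re) : DifferentiableAt ℂ WW s := by
  have hs3 : 0 < (s/3).re := by
    have : (s/3).re = s.re/3 := by simp
    rw [this]; positivity
  have hs3' : 0 < (3 * s).re := by simpa using hs
  have a1 : DifferentiableAt ℂ (fun s => F1 (s/3)) s :=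
    (F1_deriv hs3).differentiableAt.comp s (f := fun s => s / 3) (by fun_prop)
  have a2 : DifferentiableAt ℂ (fun s => F3 (s/3)) s :=
    (F3_diff hs3).comp s (f := fun s => s / 3) (by fun_prop)
  have a3 : DifferentiableAt ℂ (fun s => F1 (3*s)) s :=
    (F1_deriv hs3').differentiableAt.comp s (f := fun s => 3*s) (by fun_prop)
  have a4 : DifferentiableAt ℂ (fun s => F3 (3*s)) s :=
    (F3_diff hs3').comp s (f := fun s => 3*s) (by fun_prop)
  unfold WW
  fun_prop

lemma PS_lim_half {c : ℤ → ℝ} (hc : PolyB c) (k : ℝ) (hk : 0 < k) :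
    Filter.Tendsto (fun s : ℂ => cexp ((π * (1/4) : ℝ) * (k * s)) * PS c (1/2) (k * s))
      (Filter.comap Complex.re Filter.atTop) (nhds ((c 0 + c (-1) : ℝ))) := by
  have h := hc.tendsto (1/2) (1/4) (fun n _ => int_sq_ge n)
  have e : (∑' n : ℤ, if ((n:ℝ) + 1/2) ^ 2 = 1/4 then (c n : ℂ) else 0) = ((c 0 + c (-1) : ℝ)) := by
    rw [← tsum_half, Complex.ofReal_tsum]
    congr 1; ext n; split_ifs <;> simp
  rw [e] at h
  refine h.comp (?_ : Filter.Tendsto (fun s : ℂ => (k:ℂ) * s) _ _)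
  rw [Filter.tendsto_comap_iff]
  have : Complex.re ∘ (fun s : ℂ => (k:ℂ) * s) = fun s => k * s.re := by ext s; simp
  rw [this]
  exact Filter.tendsto_comap.const_mul_atTop hk

lemma WW_lim : Filter.Tendsto (fun s : ℂ => cexp ((5 * π / 6 : ℝ) * s) * WW s)
      (Filter.comap Complex.re Filter.atTop) (nhds 32) := by
  have a1 := PS_lim_half Bf (1/3) (by norm_num)
  have a2 := PS_lim_half Bg (1/3) (by norm_num)
  have a3 := PS_lim_half Bf 3 (by norm_num)
  have a4 := PS_lim_half Bg 3 (by norm_num)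
  have h := ((a1.mul a4).const_mul 9).sub (a2.mul a3)
  have e : (9 * (((cf 0 + cf (-1) : ℝ) : ℂ) * ((cg 0 + cg (-1) : ℝ):ℂ)) - ((cg 0 + cg (-1) : ℝ):ℂ) * ((cf 0 + cf (-1) : ℝ):ℂ)) = 32 := by
    norm_num [cf, cg]
  rw [e] at h
  refine h.congr fun s => ?_
  have e1 : cexp ((5 * π / 6 : ℝ) * s) = cexp ((π * (1/4) : ℝ) * ((1/3 : ℝ) * s)) * cexp ((π * (1/4) : ℝ) * ((3:ℝ) * s)) := by
    rw [← Complex.exp_add]; congr 1; push_cast; ring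
  rw [e1, WW, F1, F3, show s / 3 = ((1/3:ℝ):ℂ) * s by push_cast; ring, show 3 * s = ((3:ℝ):ℂ) * s by push_cast; ring]
  ring

lemma WW_disc {s : ℂ} (hs : 0 < s.re) : WW s ^ 12 = 32 ^ 12 * Dl s ^ 5 := by
  refine L_disc 5 (G := fun s => WW s ^ 12) (fun s hs => (WW_diff hs).pow 12) (fun s hs => ?_) (fun s hs => ?_) ?_ hs
  · have e1 : ((3 * s) ^ (1/2:ℂ)) ^ 12 = (3 * s) ^ 6 := by
      rw [show 12 = 2 * 6 by norm_num, pow_mul, half_sq]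
    have e2 : ((s / 3) ^ (1/2:ℂ)) ^ 12 = (s / 3) ^ 6 := by
      rw [show 12 = 2 * 6 by norm_num, pow_mul, half_sq]
    rw [WW_S hs, mul_pow, mul_pow, mul_pow, e1, e2]
    ring
  · have e1 : (cexp (π * I / 12) ^ 10) ^ 12 = 1 := by
      rw [← pow_mul, ← Complex.exp_nat_mul]
      have := Complex.exp_int_mul_two_pi_mul_I 5
      rw [← this]; congr 1; push_cast; ring
    rw [WW_T hs, mul_pow, e1, one_mul]
  · refine (WW_lim.pow 12).congr fun s => ?_
    rw [mul_pow, ← Complex.exp_nat_mul, ← Complex.exp_nat_mul]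
    congr 2
    push_cast; ring

noncomputable def TP (s : ℂ) : ℂ := T2 s * T3 s * T4 s

lemma T2_diff {s : ℂ} (hs : 0 < s.re) : DifferentiableAt ℂ T2 s := (B1.hasDerivAt _ hs).differentiableAt
lemma T3_diff {s : ℂ} (hs : 0 < s.re) : DifferentiableAt ℂ T3 s := (B1.hasDerivAt _ hs).differentiableAt
lemma T4_diff {s : ℂ} (hs : 0 < s.re) : DifferentiableAt ℂ T4 s := (Ba.hasDerivAt _ hs).differentiableAt

lemma tsum_zeroC (c : ℤ → ℝ) : (∑' n : ℤ, if ((n:ℝ) + 0) ^ 2 = 0 then (c n : ℂ) else 0) = c 0 := by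
  rw [tsum_eq_single 0]
  · simp
  · intro n hn; simp [hn]

lemma T3_lim : Filter.Tendsto T3 (Filter.comap Complex.re Filter.atTop) (nhds 1) := by
  have h := B1.tendsto 0 0 (fun n _ => by positivity)
  rw [tsum_zeroC] at h
  simp [c1] at h; exact h
lemma T4_lim : Filter.Tendsto T4 (Filter.comap Complex.re Filter.atTop) (nhds 1) := by
  have h := Ba.tendsto 0 0 (fun n _ => by positivity)
  rw [tsum_zeroC] at h
  simp [ca] at h; exact h
lemma T2_lim : Filter.Tendsto (fun s => cexp ((π * (1/4) : ℝ) * s) * T2 s) (Filter.comap Complex.re Filter.atTop) (nhds 2) := by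
  have h := PS_lim_half B1 1 one_pos
  have e : ((c1 0 + c1 (-1) : ℝ) : ℂ) = 2 := by norm_num [c1]
  rw [e] at h
  simp only [Complex.ofReal_one, one_mul] at h; exact h

lemma TP_disc {s : ℂ} (hs : 0 < s.re) : TP s ^ 8 = 256 * Dl s := by
  rw [← pow_one (Dl s)]
  refine L_disc 1 (G := fun s => TP s ^ 8) (fun s hs => (((T2_diff hs).mul (T3_diff hs)).mul (T4_diff hs)).pow 8) (fun s hs => ?_) (fun s hs => ?_) ?_ hs
  · have e1 : (s ^ (1/2:ℂ)) ^ 24 = s ^ 12 := by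
      rw [show 24 = 2 * 12 by norm_num, pow_mul, half_sq]
    simp only [TP]
    rw [T2_S hs, T3_S hs, T4_S hs, mul_one, ← e1]
    ring
  · have e1 : (cexp (π * I / 4)) ^ 8 = 1 := by
      rw [← Complex.exp_nat_mul]
      have := Complex.exp_int_mul_two_pi_mul_I 1
      rw [← this]; congr 1; push_cast; ring
    simp only [TP]
    rw [T2_T, T3_T, T4_T, mul_pow, mul_pow, mul_pow, e1]; ring
  · have := (((T2_lim.mul T3_lim).mul T4_lim).pow 8)
    norm_num at this
    refine this.congr fun s => ?_
    rw [TP, mul_pow, mul_pow, mul_pow, ← Complex.exp_nat_mul, pow_one]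
    rw [show 2 * π * s = (8:ℕ) * (π * (1/4) * s) by push_cast; ring]
    try norm_num
    try ring

noncomputable def ww (y : ℝ) : ℝ := 9 * f1 (y / 3) * f3 (3 * y) - f3 (y / 3) * f1 (3 * y)

lemma WWr (y : ℝ) : WW y = ww y := by
  unfold WW ww
  rw [show (y:ℂ)/3 = ((y/3 : ℝ):ℂ) by push_cast; rfl, show 3 * (y:ℂ) = ((3 * y : ℝ):ℂ) by push_cast; rfl,
    F1r, F1r, F3r, F3r]
  push_cast; ring

lemma ww_cont : ContinuousOn ww (Set.Ioi 0) := by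
  intro y hy
  have := (WW_diff (s := (y:ℂ)) (by simpa using hy)).continuousAt
  have h2 : ContinuousAt (fun y : ℝ => (WW y).re) y :=
    Complex.continuous_re.continuousAt.comp (ContinuousAt.comp (f := fun y : ℝ => (y:ℂ)) this Complex.continuous_ofReal.continuousAt)
  simp only [WWr, Complex.ofReal_re] at h2
  exact h2.continuousWithinAt

lemma ww_pow {y : ℝ} (hy : 0 < y) : ww y ^ 12 = 2 ^ 20 * (r2 y * r3 y * r4 y) ^ 40 := by
  have h1 := WW_disc (s := (y:ℂ)) (by simpa using hy)
  have h2 := TP_disc (s := (y:ℂ)) (by simpa using hy)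
  have : WW y ^ 12 = 2 ^ 20 * TP y ^ 40 := by
    rw [h1, show 40 = 8 * 5 by norm_num, pow_mul, h2]; ring
  rw [WWr, TP, T2r, T3r, T4r] at this
  exact_mod_cast this

lemma rp_pos {y : ℝ} (hy : 0 < y) : 0 < r2 y * r3 y * r4 y :=
  mul_pos (mul_pos (r2_pos hy) (r3_pos hy)) (r4_pos hy)

lemma ww_pos {y : ℝ} (hy : 0 < y) : 0 < ww y := by
  have hne : ∀ y, 0 < y → ww y ≠ 0 := by
    intro y hy h
    have := ww_pow hy
    rw [h] at this
    have hp := rp_pos hy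
    have : 0 < 2 ^ 20 * (r2 y * r3 y * r4 y) ^ 40 := by positivity
    linarith
  have hl : Filter.Tendsto (fun y : ℝ => rexp (5 * π / 6 * y) * ww y) Filter.atTop (nhds 32) := by
    have h1 : Filter.Tendsto (fun y : ℝ => (y:ℂ)) Filter.atTop (Filter.comap Complex.re Filter.atTop) := by
      rw [Filter.tendsto_comap_iff]; exact Filter.tendsto_id
    have h2 := (Complex.continuous_re.tendsto _).comp (WW_lim.comp h1)
    refine h2.congr fun y => ?_
    simp only [Function.comp, WWr]
    rw [← Complex.ofReal_mul, ← Complex.ofReal_exp, ← Complex.ofReal_mul, Complex.ofReal_re]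
  obtain ⟨Y, hY⟩ := ((hl.eventually (lt_mem_nhds (show (0:ℝ) < 32 by norm_num))).and (Filter.eventually_gt_atTop 0)).exists
  have hYp : 0 < ww Y := by
    have := hY.1
    exact (mul_pos_iff_of_pos_left (Real.exp_pos _)).mp this
  by_contra hn
  have hlt : ww y < 0 := lt_of_le_of_ne (not_lt.mp hn) (hne y hy)
  have := isPreconnected_Ioi.intermediate_value (Set.mem_Ioi.mpr hy) (Set.mem_Ioi.mpr hY.2) ww_cont
  obtain ⟨z, hz, hz0⟩ := this ⟨hlt.le, hYp.le⟩
  exact hne z hz hz0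

lemma ww_eq {y : ℝ} (hy : 0 < y) : (r2 y * r3 y * r4 y) ^ ((10:ℝ)/3) = 2 ^ (-(5:ℝ)/3) * ww y := by
  have hp := rp_pos hy
  have hw := ww_pos hy
  refine (pow_left_inj₀ (by positivity) (by positivity) (show 12 ≠ 0 by norm_num)).mp ?_
  rw [mul_pow, ww_pow hy, ← Real.rpow_natCast, ← Real.rpow_mul hp.le, ← Real.rpow_natCast (2 ^ (-(5:ℝ)/3)),
    ← Real.rpow_mul (by norm_num), ← mul_assoc]
  rw [show (-(5:ℝ)/3 * ((12:ℕ):ℝ)) = -((20:ℕ):ℝ) by norm_num, Real.rpow_neg (by norm_num), Real.rpow_natCast,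
    show ((10:ℝ)/3 * ((12:ℕ):ℝ)) = ((40:ℕ):ℝ) by norm_num, Real.rpow_natCast]
  norm_num


noncomputable def EE (s : ℂ) : ℂ := T2 s ^ 8 + T3 s ^ 8 + T4 s ^ 8

lemma EE_diff {s : ℂ} (hs : 0 < s.re) : DifferentiableAt ℂ EE s :=
  (((T2_diff hs).pow 8).add ((T3_diff hs).pow 8)).add ((T4_diff hs).pow 8)

lemma EE_S {s : ℂ} (hs : 0 < s.re) : EE s⁻¹ = s ^ 4 * EE s := by
  have e1 : (s ^ (1/2:ℂ)) ^ 8 = s ^ 4 := by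
    rw [show 8 = 2 * 4 by norm_num, pow_mul, half_sq]
  rw [EE, EE, T2_S hs, T3_S hs, T4_S hs, ← e1]
  ring

lemma EE_T (s : ℂ) : EE (s - I) = EE s := by
  have e1 : (cexp (π * I / 4)) ^ 8 = 1 := by
    rw [← Complex.exp_nat_mul]
    have := Complex.exp_int_mul_two_pi_mul_I 1
    rw [← this]; congr 1; push_cast; ring
  rw [EE, EE, T2_T, T3_T, T4_T, mul_pow, e1]; ring

lemma T2_lim0 : Filter.Tendsto T2 (Filter.comap Complex.re Filter.atTop) (nhds 0) := by
  have h1 : Filter.Tendsto (fun s : ℂ => cexp (-((π * (1/4) : ℝ) * s))) (Filter.comap Complex.re Filter.atTop) (nhds 0) := by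
    rw [tendsto_zero_iff_norm_tendsto_zero]
    simp only [Complex.norm_exp]
    have : Filter.Tendsto (fun x : ℝ => Real.exp (-(π * (1/4) * x))) Filter.atTop (nhds 0) := by
      apply Real.tendsto_exp_atBot.comp
      apply Filter.tendsto_neg_atTop_atBot.comp
      exact Filter.tendsto_id.const_mul_atTop (by positivity)
    refine (this.comp Filter.tendsto_comap).congr fun s => ?_
    simp
  have := h1.mul T2_lim
  rw [zero_mul] at this
  refine this.congr fun s => ?_
  rw [← mul_assoc, ← Complex.exp_add]; simp

lemma EE_lim : Filter.Tendsto EE (Filter.comap Complex.re Filter.atTop) (nhds 2) := by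
  have := ((T2_lim0.pow 8).add (T3_lim.pow 8)).add (T4_lim.pow 8)
  norm_num at this
  exact this

open UpperHalfPlane hiding I in
lemma E4_eq (z : UpperHalfPlane) : ModularForm.E₄ z = EE (-I * (z:ℂ)) / 2 := by
  have hl' := EE_lim.comp tendsto_s
  let F := mkMF (fun z => EE (-I * (z:ℂ))) 4 (mdiff_s @EE_diff) (s_S (by norm_num) (fun s hs => EE_S hs)) (s_T (fun s _ => EE_T s))
    (hl'.isBigO_one ℝ)
  obtain ⟨c, hc⟩ : ∃ c : ℂ, c • ModularForm.E₄ = F :=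
    (finrank_eq_one_iff_of_nonzero' ModularForm.E₄ (EisensteinSeries.E_ne_zero _ ⟨2, rfl⟩)).mp
      (Module.rank_eq_one_iff_finrank_eq_one.mp ModularForm.levelOne_weight_four_rank_one) _
  have h1 : (qExpansion 1 F).coeff 0 = 2 := by
    rw [qExpansion_coeff_zero one_pos
      (ModularFormClass.analyticAt_cuspFunction_zero _ one_pos one_mem_strictPeriods_SL)
      (SlashInvariantFormClass.periodic_comp_ofComplex _ one_mem_strictPeriods_SL)]
    exact hl'.limUnder_eq
  have h2 : (qExpansion 1 F).coeff 0 = c := by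
    rw [← hc, FunLike.coe_smul, ModularForm.qExpansion_smul one_pos one_mem_strictPeriods_SL, PowerSeries.coeff_smul, 
      EisensteinSeries.E_qExpansion_coeff_zero _ ⟨2, rfl⟩]
    simp
  have h3 : c * ModularForm.E₄ z = EE (-I * (z:ℂ)) := by
    change _ = F z
    rw [← hc]; rfl
  rw [← h3, ← h2, h1]; ring

open UpperHalfPlane hiding I in
lemma eis_sum (z : UpperHalfPlane) :
    ∑' x : ℤ × ℤ, (1 / ((x.1:ℂ) * z + x.2) ^ 4) = π ^ 4 / 90 * EE (-I * (z:ℂ)) := by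
  have h := tsum_eisSummand_eq_riemannZeta_mul_eisensteinSeries (k := 4) (by norm_num) z
  have h2 : eisensteinSeries (N := 1) 0 (4:ℕ) z = EE (-I * (z:ℂ)) := by
    have := E4_eq z
    rw [show ModularForm.E₄ z = (1 / 2 : ℂ) • EisensteinSeries.eisensteinSeriesSIF (N := 1) 0 4 z from rfl,
    EisensteinSeries.eisensteinSeriesSIF_apply 0 4 z] at this
    simp only [smul_eq_mul] at this
    push_cast
    linear_combination 2 * this
  rw [h2] at h
  push_cast at h
  rw [riemannZeta_four] at h
  rw [← h, ← (finTwoArrowEquiv ℤ).symm.tsum_eq]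
  refine tsum_congr fun x => ?_
  simp [EisensteinSeries.eisSummand]

open UpperHalfPlane hiding I in
lemma eis_summable (z : UpperHalfPlane) :
    Summable fun x : ℤ × ℤ => (1 / ((x.1:ℂ) * z + x.2) ^ 4) := by
  refine (summable_prod_eisSummand (k := 4) (by norm_num) z).congr fun x => ?_
  simp [EisensteinSeries.eisSummand]


lemma split2 {h : ℤ × ℤ → ℝ} (hh : Summable h) :
    ∑' p, h p = ∑' p : ℤ × ℤ, h (2 * p.1, p.2) + ∑' p : ℤ × ℤ, h (2 * p.1 + 1, p.2) := by
  have i1 : Function.Injective (fun p : ℤ × ℤ => (2 * p.1, p.2)) := by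
    rintro ⟨a, b⟩ ⟨c, d⟩ h; simp at h ⊢; omega
  have i2 : Function.Injective (fun p : ℤ × ℤ => (2 * p.1 + 1, p.2)) := by
    rintro ⟨a, b⟩ ⟨c, d⟩ h; simp at h ⊢; omega
  have s1 : Summable (fun p : ℤ × ℤ => h (2 * p.1, p.2)) := hh.comp_injective i1
  have s2 : Summable (fun p : ℤ × ℤ => h (2 * p.1 + 1, p.2)) := hh.comp_injective i2
  refine HasSum.tsum_eq ?_
  refine HasSum.add_isCompl ?_ (i1.hasSum_range_iff.mpr s1.hasSum) (i2.hasSum_range_iff.mpr s2.hasSum)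
  rw [isCompl_iff, Set.disjoint_iff, codisjoint_iff_le_sup]
  constructor
  · rintro ⟨x, y⟩ ⟨⟨⟨a, b⟩, h1⟩, ⟨⟨c, d⟩, h2⟩⟩
    simp at h1 h2
    omega
  · rintro ⟨x, y⟩ _
    rcases Int.even_or_odd' x with ⟨k, rfl | rfl⟩
    · left; exact ⟨(k, y), rfl⟩
    · right; exact ⟨(k, y), rfl⟩

def eqShear : ℤ × ℤ ≃ ℤ × ℤ where
  toFun p := (p.1 - p.2, p.2)
  invFun p := (p.1 + p.2, p.2)
  left_inv p := by simp
  right_inv p := by simp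

def eqA : ℤ × ℤ ≃ ℤ × ℤ where
  toFun p := (-p.1, p.2 + p.1)
  invFun p := (-p.1, p.2 + p.1)
  left_inv p := by simp
  right_inv p := by simp

def eqB : ℤ × ℤ ≃ ℤ × ℤ where
  toFun p := (p.1 + p.2, -1 - p.2)
  invFun p := (p.1 + p.2 + 1, -1 - p.2)
  left_inv p := by ext <;> simp
  right_inv p := by
    ext
    · simp only; ring
    · simp

lemma lattice {g : ℤ → ℤ → ℝ} (hg : Summable fun p : ℤ × ℤ => g p.1 p.2) (ho : ∀ a b, g a (-b) = - g a b) :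
    ∑' p : ℤ × ℤ, ca p.1 * ca p.2 * g (2 * p.1 + 1) (2 * p.2 + 1) =
      2 * ∑' p : ℤ × ℤ, g (p.1 + 4 * p.2) p.1 := by
  have iF : Function.Injective (fun p : ℤ × ℤ => (p.1 + 4 * p.2, p.1)) := by
    rintro ⟨a, b⟩ ⟨c, d⟩ h; simp at h ⊢; omega
  have sF : Summable fun p : ℤ × ℤ => g (p.1 + 4 * p.2) p.1 := hg.comp_injective iF
  rw [split2 sF]
  have e0 : ∑' p : ℤ × ℤ, g (2 * p.1 + 4 * p.2) (2 * p.1) = 0 := by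
    have := eqA.tsum_eq (fun p : ℤ × ℤ => g (2 * p.1 + 4 * p.2) (2 * p.1))
    have h2 : ∀ p : ℤ × ℤ, g (2 * (eqA p).1 + 4 * (eqA p).2) (2 * (eqA p).1) = - g (2 * p.1 + 4 * p.2) (2 * p.1) := by
      intro p
      rw [← ho]
      congr 1 <;> simp only [eqA, Equiv.coe_fn_mk] <;> ring
    simp only [h2, tsum_neg] at this
    linarith
  simp only [e0, zero_add]
  have iD : Function.Injective (fun p : ℤ × ℤ => (2 * (p.1 + p.2) + 1, 2 * p.2 + 1)) := by
    rintro ⟨a, b⟩ ⟨c, d⟩ h; simp at h ⊢; omega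
  have sD0 : Summable fun p : ℤ × ℤ => g (2 * (p.1 + p.2) + 1) (2 * p.2 + 1) := hg.comp_injective iD
  have sD : Summable fun p : ℤ × ℤ => ca p.1 * g (2 * (p.1 + p.2) + 1) (2 * p.2 + 1) := by
    rw [← summable_abs_iff] at sD0 ⊢
    refine sD0.congr fun p => ?_
    rw [abs_mul, abs_ca, one_mul]
  have e1 : ∑' p : ℤ × ℤ, ca p.1 * ca p.2 * g (2 * p.1 + 1) (2 * p.2 + 1) = 
      ∑' p : ℤ × ℤ, ca p.1 * g (2 * (p.1 + p.2) + 1) (2 * p.2 + 1) := by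
    rw [← eqShear.symm.tsum_eq]
    refine tsum_congr fun p => ?_
    simp only [eqShear, Equiv.coe_fn_symm_mk]
    rw [ca_add]
    linear_combination ca p.1 * g (2 * (p.1 + p.2) + 1) (2 * p.2 + 1) * ca_sq p.2
  rw [e1, split2 sD]
  have c0 : ∀ n, ca (2 * n) = 1 := fun n => by rw [two_mul, ca_add, ca_sq]
  have c1' : ∀ n, ca (2 * n + 1) = -1 := fun n => by rw [ca_add, c0, ca_one]; ring
  simp only [c0, c1', one_mul]
  have e2 : ∑' p : ℤ × ℤ, g (2 * (2 * p.1 + p.2) + 1) (2 * p.2 + 1) = ∑' p : ℤ × ℤ, g (2 * p.1 + 1 + 4 * p.2) (2 * p.1 + 1) := by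
    rw [← (Equiv.prodComm ℤ ℤ).tsum_eq]
    refine tsum_congr fun p => ?_
    simp only [Equiv.prodComm_apply, Prod.swap]
    congr 1; ring
  have e3 : ∑' p : ℤ × ℤ, -1 * g (2 * (2 * p.1 + 1 + p.2) + 1) (2 * p.2 + 1) = ∑' p : ℤ × ℤ, g (2 * (2 * p.1 + p.2) + 1) (2 * p.2 + 1) := by
    rw [← eqB.tsum_eq]
    refine tsum_congr fun p => ?_
    rw [neg_one_mul, ← ho]
    congr 1 <;> simp only [eqB, Equiv.coe_fn_mk] <;> ring
  rw [e3, e2]; ring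

noncomputable def gg (a b : ℤ) : ℝ := (1 / ((b:ℂ) * (3 * I) + a) ^ 4).im

lemma gg_eq (a b : ℤ) : gg a b = 12 * (a * b * (9 * b ^ 2 - a ^ 2)) / ((a:ℝ) ^ 2 + 9 * b ^ 2) ^ 4 := by
  rw [gg]
  by_cases h : ((b:ℂ) * (3 * I) + a) = 0
  · have h1 := congrArg Complex.re h
    have h2 := congrArg Complex.im h
    simp at h1 h2
    simp [h1, h2]
  have h3 : ((b:ℂ) * (3 * I) + a) * (a - b * (3 * I)) = ((a:ℝ) ^ 2 + 9 * (b:ℝ) ^ 2 : ℝ) := by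
    push_cast; linear_combination (-9 * (b:ℂ)^2) * I_sq
  have h4 : (a:ℝ) ^ 2 + 9 * (b:ℝ) ^ 2 ≠ 0 := by
    intro h0
    apply h
    have h5 : (a:ℝ) = 0 := by nlinarith [sq_nonneg (a:ℝ), sq_nonneg (b:ℝ)]
    have h6 : (b:ℝ) = 0 := by nlinarith [sq_nonneg (a:ℝ), sq_nonneg (b:ℝ)]
    have h5' : a = 0 := by exact_mod_cast h5
    have h6' : b = 0 := by exact_mod_cast h6
    simp [h5', h6']
  have h4' : (((a:ℝ) ^ 2 + 9 * (b:ℝ) ^ 2 : ℝ) : ℂ) ≠ 0 := by exact_mod_cast h4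
  have h5 : 1 / ((b:ℂ) * (3 * I) + a) ^ 4 = (((a:ℝ)^4 - 54 * a^2*b^2 + 81 * b^4 : ℝ) + ((12 * (a * b * (9 * b ^ 2 - a ^ 2)) : ℝ):ℂ) * I) * ((((a:ℝ) ^ 2 + 9 * (b:ℝ) ^ 2) ^ 4)⁻¹ : ℝ) := by
    rw [Complex.ofReal_inv, Complex.ofReal_pow, ← h3, ← div_eq_mul_inv, mul_pow]
    have : ((a:ℂ) - b * (3 * I)) ≠ 0 := by
      intro h0; rw [h0, mul_zero] at h3; exact h4' h3.symm
    have hI3 : I ^ 3 = -I := by rw [pow_succ, I_sq]; ring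
    have hn : (((a:ℝ)^4 - 54 * a^2*b^2 + 81 * b^4 : ℝ) + ((12 * (a * b * (9 * b ^ 2 - a ^ 2)) : ℝ):ℂ) * I) = ((a:ℂ) - b * (3 * I)) ^ 4 := by
      push_cast
      ring_nf
      simp only [I_pow_four, hI3, I_sq]
      ring
    rw [hn]
    generalize (a:ℂ) - b * (3 * I) = u at *
    generalize (b:ℂ) * (3 * I) + a = v at *
    field_simp
  rw [h5, Complex.im_mul_ofReal]
  simp only [Complex.add_im, Complex.ofReal_im, Complex.im_ofReal_mul, Complex.I_im]
  ring

lemma gg_odd (a b : ℤ) : gg a (-b) = - gg a b := by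
  rw [gg_eq, gg_eq]; push_cast; ring

lemma gg_summable : Summable fun p : ℤ × ℤ => gg p.1 p.2 := by
  have h := eis_summable ⟨3 * I, by simp⟩
  have h2 := (Complex.hasSum_im h.hasSum).summable
  have h3 := (Equiv.prodComm ℤ ℤ).summable_iff.mpr h2
  exact h3

lemma gg_sum : ∑' p : ℤ × ℤ, gg (p.1 + 4 * p.2) p.1 = 4⁻¹ ^ 4 * (π ^ 4 / 90 * EE ((3 - I) / 4)).im := by
  have h := eis_sum ⟨(1 + 3 * I) / 4, by simp⟩
  have hs := eis_summable ⟨(1 + 3 * I) / 4, by simp⟩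
  have h2 := (Complex.hasSum_im hs.hasSum).tsum_eq
  have e : -I * ((1 + 3 * I) / 4) = (3 - I) / 4 := by linear_combination (-3/4) * I_sq
  rw [h] at h2
  change _ = (π ^ 4 / 90 * EE (-I * ((1 + 3 * I) / 4))).im at h2
  rw [e] at h2
  rw [← h2, ← tsum_mul_left]
  refine tsum_congr fun p => ?_
  rw [gg]
  have : ((p.1:ℂ) * (3 * I) + ((p.1 + 4 * p.2 : ℤ):ℂ)) = 4 * (p.1 * ((1 + 3 * I) / 4) + p.2) := by push_cast; ring
  rw [this, mul_pow, one_div, mul_inv, show ((4:ℂ) ^ 4)⁻¹ = ((4⁻¹ ^ 4 : ℝ) : ℂ) by push_cast; norm_num, Complex.im_ofReal_mul, one_div]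

lemma EE_im : (EE ((3 - I) / 4)).im = 120 * (r2 3 ^ 2 * r4 3 ^ 2 * (r4 3 ^ 4 - r2 3 ^ 4)) := by
  have h1 : 0 < ((3 - I) / 4).re := by norm_num
  have h2 : 0 < (2 * ((3 - I) / 4)).re := by norm_num
  have a1 := T3_sq h1
  have a2 := T4_sq h1
  have a3 := T2_sq h1
  have b1 := T3_sq h2
  have b3 := T2_sq h2
  have e : 2 * (2 * ((3 - I) / 4)) = ((3:ℝ):ℂ) - I := by push_cast; ring
  rw [e, T3_T, T2_T, T4r, T2r] at b1 b3
  have e8 : cexp (π * I / 4) ^ 2 = I := by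
    rw [← Complex.exp_nat_mul]
    refine Eq.trans ?_ Complex.exp_pi_div_two_mul_I
    congr 1; push_cast; ring
  set A := T3 (2 * ((3 - I) / 4))
  set B := T2 (2 * ((3 - I) / 4))
  have key : EE ((3 - I) / 4) = 2 * (A^2)^4 + 28 * (A^2)^2 * (B^2)^2 + 2 * (B^2)^4 := by
    rw [EE, show T2 ((3 - I) / 4) ^ 8 = (T2 ((3 - I) / 4) ^ 2) ^ 4 by ring,
      show T3 ((3 - I) / 4) ^ 8 = (T3 ((3 - I) / 4) ^ 2) ^ 4 by ring,
      show T4 ((3 - I) / 4) ^ 8 = (T4 ((3 - I) / 4) ^ 2) ^ 4 by ring, a1, a2, a3]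
    ring
  have key2 : EE ((3 - I) / 4) = 2 * (((r4 3:ℂ))^2 + cexp (π * I / 4) ^ 2 * (r2 3:ℂ)^2)^4
      + 112 * (((r4 3:ℂ))^2 + cexp (π * I / 4) ^ 2 * (r2 3:ℂ)^2)^2 * (cexp (π * I / 4) ^ 2 * (r2 3:ℂ)^2 * (r4 3:ℂ)^2)
      + 32 * (cexp (π * I / 4) ^ 2 * (r2 3:ℂ)^2 * (r4 3:ℂ)^2) ^ 2 := by
    rw [key, b1, b3]; ring
  have hI3 : I ^ 3 = -I := by rw [pow_succ, I_sq]; ring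
  have key3 : EE ((3 - I) / 4) = ((2 * (r4 3^8 - 6 * r4 3^4*r2 3^4 + r2 3^8) - 224 * r4 3^4 * r2 3^4 - 32 * r4 3^4 * r2 3^4 : ℝ):ℂ)
     + ((120 * (r2 3 ^ 2 * r4 3 ^ 2 * (r4 3 ^ 4 - r2 3 ^ 4)) : ℝ) : ℂ) * I := by
    rw [key2, e8]
    push_cast
    ring_nf
    simp only [I_pow_four, hI3, I_sq]
    ring
  rw [key3]
  simp only [Complex.add_im, Complex.ofReal_im, Complex.im_ofReal_mul, Complex.I_im]
  ring


lemma int3 {r : ℝ} (hr : 0 < r) : ∫ y in Set.Ioi (0:ℝ), y ^ 3 * rexp (-(r * y)) = 6 / r ^ 4 := by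
  have h := Real.integral_rpow_mul_exp_neg_mul_Ioi (a := 4) (by norm_num) hr
  rw [show (4:ℝ) = ((3:ℕ):ℝ) + 1 by norm_num, Real.Gamma_nat_eq_factorial] at h
  norm_num at h
  rw [h]
  field_simp

lemma int3_int {r : ℝ} (hr : 0 < r) : IntegrableOn (fun y : ℝ => y ^ 3 * rexp (-(r * y))) (Set.Ioi 0) := by
  by_contra h
  have := int3 hr
  rw [integral_undef h] at this
  have : 0 < 6 / r ^ 4 := by positivity
  linarith

noncomputable def tt' (p : ℤ × ℤ) (y : ℝ) : ℝ :=
  ca p.1 * ca p.2 * ((2 * p.1 + 1) * (2 * p.2 + 1) * (9 * (2 * p.2 + 1) ^ 2 - (2 * p.1 + 1) ^ 2)) *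
   (y ^ 3 * rexp (-(π / 12 * ((2 * p.1 + 1) ^ 2 + 9 * (2 * p.2 + 1) ^ 2) * y)))

lemma ww_sum {y : ℝ} (hy : 0 < y) : y ^ 3 * ww y = ∑' p, tt' p y := by
  have h3 : 0 < y / 3 := by positivity
  have h3' : 0 < 3 * y := by positivity
  have a1 := (Bf.summableR (1/2) h3).norm
  have a2 := (Bg.summableR (1/2) h3).norm
  have b1 := (Bf.summableR (1/2) h3').norm
  have b2 := (Bg.summableR (1/2) h3').norm
  have s1 := summable_mul_of_summable_norm a1 b2
  have s2 := summable_mul_of_summable_norm a2 b1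
  rw [ww, f1, f3, mul_assoc, PR, PR, PR, PR, tsum_mul_tsum_of_summable_norm a1 b2, tsum_mul_tsum_of_summable_norm a2 b1,
    ← tsum_mul_left, ← (s1.mul_left 9).tsum_sub s2, ← tsum_mul_left]
  refine tsum_congr fun p => ?_
  have e : rexp (-(π / 12 * ((2 * p.1 + 1) ^ 2 + 9 * (2 * p.2 + 1) ^ 2) * y)) =
     rexp (-(π * (p.1 + 1/2) ^ 2) * (y / 3)) * rexp (-(π * (p.2 + 1/2) ^ 2) * (3 * y)) := by
    rw [← Real.exp_add]; congr 1; ring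
  rw [tt', e]; simp only [cf, cg, ca]
  ring

lemma pp_pos (p : ℤ × ℤ) : (0:ℝ) < (2 * p.1 + 1) ^ 2 + 9 * (2 * p.2 + 1) ^ 2 := by
  have : ((2 * p.1 + 1 : ℤ):ℝ) ≠ 0 := by exact_mod_cast (by omega)
  push_cast at this
  positivity

lemma tt_int (p : ℤ × ℤ) : IntegrableOn (tt' p) (Set.Ioi 0) := by
  have := pp_pos p
  exact (int3_int (r := π / 12 * ((2 * p.1 + 1) ^ 2 + 9 * (2 * p.2 + 1) ^ 2)) (by positivity)).const_mul _

lemma tt_val (p : ℤ × ℤ) : ∫ y in Set.Ioi (0:ℝ), tt' p y =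
    12 ^ 4 / (2 * π ^ 4) * (ca p.1 * ca p.2 * gg (2 * p.1 + 1) (2 * p.2 + 1)) := by
  have := pp_pos p
  unfold tt'
  rw [MeasureTheory.integral_const_mul, int3 (by positivity), gg_eq]
  push_cast
  field_simp
  try ring

lemma tt_norm (p : ℤ × ℤ) : ∫ y in Set.Ioi (0:ℝ), ‖tt' p y‖ =
    12 ^ 4 / (2 * π ^ 4) * |gg (2 * p.1 + 1) (2 * p.2 + 1)| := by
  have h := pp_pos p
  have e : ∫ y in Set.Ioi (0:ℝ), ‖tt' p y‖ = |ca p.1 * ca p.2 * ((2 * p.1 + 1) * (2 * p.2 + 1) * (9 * (2 * p.2 + 1) ^ 2 - (2 * p.1 + 1) ^ 2))| * ∫ y in Set.Ioi (0:ℝ), (y ^ 3 * rexp (-(π / 12 * ((2 * p.1 + 1) ^ 2 + 9 * (2 * p.2 + 1) ^ 2) * y))) := by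
    rw [← MeasureTheory.integral_const_mul]
    refine setIntegral_congr_fun measurableSet_Ioi fun y hy => ?_
    have hy' : (0:ℝ) < y := hy
    simp only [tt', Real.norm_eq_abs]
    rw [abs_mul, abs_of_pos (show 0 < y ^ 3 * rexp (-(π / 12 * ((2 * p.1 + 1) ^ 2 + 9 * (2 * p.2 + 1) ^ 2) * y)) by positivity)]
  rw [e, int3 (by positivity), gg_eq, abs_mul, abs_mul, abs_ca, abs_ca]
  push_cast
  rw [abs_div, abs_mul (12:ℝ), abs_of_pos (pow_pos h 4), abs_of_pos (show (0:ℝ) < 12 by norm_num)]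
  generalize |((2 * (p.1:ℝ) + 1) * (2 * p.2 + 1) * (9 * (2 * p.2 + 1) ^ 2 - (2 * p.1 + 1) ^ 2))| = u
  field_simp
  try ring

lemma odd_summable {g : ℤ → ℤ → ℝ} (hg : Summable fun p : ℤ × ℤ => g p.1 p.2) :
    Summable fun p : ℤ × ℤ => g (2 * p.1 + 1) (2 * p.2 + 1) := by
  have inj : Function.Injective (fun p : ℤ × ℤ => (2 * p.1 + 1, 2 * p.2 + 1)) := by
    intro p q h
    have h1 : 2 * p.1 + 1 = 2 * q.1 + 1 := congrArg Prod.fst h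
    have h2 : 2 * p.2 + 1 = 2 * q.2 + 1 := congrArg Prod.snd h
    ext
    · omega
    · omega
  exact hg.comp_injective inj

lemma gg_odd_summable : Summable fun p : ℤ × ℤ => gg (2 * p.1 + 1) (2 * p.2 + 1) :=
  odd_summable gg_summable

lemma tt_norm_summable : Summable fun p : ℤ × ℤ => ∫ y in Set.Ioi (0:ℝ), ‖tt' p y‖ := by
  simp only [tt_norm]; exact (summable_abs_iff.mpr gg_odd_summable).mul_left _

lemma int_ww1 : ∫ y in Set.Ioi (0:ℝ), y ^ 3 * ww y = ∫ y in Set.Ioi (0:ℝ), ∑' p, tt' p y :=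
    setIntegral_congr_fun measurableSet_Ioi fun y hy => by
      have hy' : (0:ℝ) < y := hy
      exact ww_sum hy'

lemma int_ww2 : ∑' p, ∫ y in Set.Ioi (0:ℝ), tt' p y = ∫ y in Set.Ioi (0:ℝ), ∑' p, tt' p y :=
  (hasSum_integral_of_summable_integral_norm (F := tt') (μ := volume.restrict (Set.Ioi (0:ℝ))) (fun p => tt_int p)
    tt_norm_summable).tsum_eq

lemma int_ww : ∫ y in Set.Ioi (0:ℝ), y ^ 3 * ww y = 108 * (r2 3 ^ 2 * r4 3 ^ 2 * (r4 3 ^ 4 - r2 3 ^ 4)) := by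
  rw [int_ww1, ← int_ww2]
  simp only [tt_val]
  rw [tsum_mul_left, lattice gg_summable gg_odd, gg_sum,
    show (π:ℂ) ^ 4 / 90 = ((π ^ 4 / 90 : ℝ):ℂ) by push_cast; ring, Complex.im_ofReal_mul, EE_im]
  have := Real.pi_pos
  generalize r2 3 ^ 2 * r4 3 ^ 2 * (r4 3 ^ 4 - r2 3 ^ 4) = u
  field_simp
  ring

lemma final : ∫ t in (0:ℝ)..1, (3:ℝ) ^ ((5:ℝ)/4) * (ellipticK (√t)) ^ 3 / (2 ^ ((5:ℝ)/6) * (t * (1 - t)) ^ ((1:ℝ)/6)) =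
    3 ^ ((3:ℝ)/2) * (2 - √3) * Real.Gamma (1/4) ^ 8 / (2 ^ 7 * π ^ 2) := by
  have e : ∫ t in (0:ℝ)..1, (3:ℝ) ^ ((5:ℝ)/4) * (ellipticK (√t)) ^ 3 / (2 ^ ((5:ℝ)/6) * (t * (1 - t)) ^ ((1:ℝ)/6)) =
    (3:ℝ) ^ ((5:ℝ)/4) / 2 ^ ((5:ℝ)/6) * ∫ t in (0:ℝ)..1, ellipticK (√t) ^ 3 / (t * (1 - t)) ^ ((1:ℝ)/6) := by
    rw [← intervalIntegral.integral_const_mul]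
    congr 1; ext t
    rw [mul_div_mul_comm]
  have e2 : ∫ y in Set.Ioi (0:ℝ), y ^ 3 * (r2 y * r3 y * r4 y) ^ ((10:ℝ)/3) =
      2 ^ (-(5:ℝ)/3) * ∫ y in Set.Ioi (0:ℝ), y ^ 3 * ww y := by
    rw [← MeasureTheory.integral_const_mul]
    refine setIntegral_congr_fun measurableSet_Ioi fun y hy => ?_
    change y ^ 3 * (r2 y * r3 y * r4 y) ^ ((10:ℝ)/3) = 2 ^ (-(5:ℝ)/3) * (y ^ 3 * ww y)
    rw [ww_eq hy]; ring
  rw [e, change_var, e2, int_ww, F_val, r3_one_gamma]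
  have q1 : (3:ℝ) ^ ((5:ℝ)/4) * 3 ^ ((1:ℝ)/4) = 3 ^ ((3:ℝ)/2) := by
    rw [← Real.rpow_add (by norm_num)]; norm_num
  have q2 : (2:ℝ) ^ (-(5:ℝ)/3) * √2 = 2 ^ ((5:ℝ)/6) / 4 := by
    rw [Real.sqrt_eq_rpow, ← Real.rpow_add (by norm_num), show (4:ℝ) = 2 ^ (2:ℝ) by norm_num, ← Real.rpow_sub (by norm_num)]
    norm_num
  rw [← q1]
  have h2 : (0:ℝ) < 2 ^ ((5:ℝ)/6) := by positivity
  generalize (3:ℝ) ^ ((5:ℝ)/4) = a at *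
  generalize (3:ℝ) ^ ((1:ℝ)/4) = b at *
  generalize √3 = c at *
  generalize (2:ℝ) ^ ((5:ℝ)/6) = d at *
  generalize (2:ℝ) ^ (-(5:ℝ)/3) = f at *
  generalize √2 = g at *
  have : a / d * (π ^ 4 / 8 * (f * (108 * (Real.Gamma (1 / 4) ^ 8 / (16 * π ^ 6) * (g * b * (2 - c) / 27))))) 
    = a / d * (π ^ 4 / 8 * ((f * g) * (108 * (Real.Gamma (1 / 4) ^ 8 / (16 * π ^ 6) * (b * (2 - c) / 27))))) := by ring
  rw [this, q2]
  field_simp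
  ring

theorem stmt18 :
    (∫ t in (0:ℝ)..1, (3:ℝ) ^ ((5:ℝ)/4) * (ellipticK (Real.sqrt t)) ^ 3 /
        ((2:ℝ) ^ ((5:ℝ)/6) * (t * (1 - t)) ^ ((1:ℝ)/6)))
      = (3:ℝ) ^ ((3:ℝ)/2) * (2 - Real.sqrt 3) * Real.Gamma (1/4) ^ 8 / (2 ^ 7 * π ^ 2) := by
  exact final
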